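/- Let {Γ_t}, t ∈ [0,T), be a curve shortening flow of simple closed curves on the unit sphere S² ⊂ ℝ³. Suppose that at t = 0 there exists a > 0 such that for every pair of points x, y ∈ Γ₀, d(x,y)/L(0) ≥ a⁻¹ arctan((a/π) sin(π ℓ(x,y,0)/L(0))). Then for every t ∈ [0,T) and every pair of points x, y ∈ Γ_t, d(x,y)/L(t) ≥ (a e^{−4π²τ(t)})⁻¹ arctan((a e^{−4π²τ(t)}/π) sin(π ℓ(x,y,t)/L(t))), where τ(t) := ∫₀ᵗ L(s)⁻² ds. -/

import Mathlib

open Real MeasureTheory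

noncomputable section

/-- Arclength derivative `∂_s f = |∂_u γ|⁻¹ ∂_u f` along the family of curves `u ↦ γ u t`. -/
def pS (γ f : ℝ → ℝ → EuclideanSpace ℝ (Fin 3)) (u t : ℝ) : EuclideanSpace ℝ (Fin 3) :=
  ‖deriv (fun v => γ v t) u‖⁻¹ • deriv (fun v => f v t) u

/-- The geodesic curvature vector `∂_s²γ + γ` of the spherical curve `u ↦ γ u t`. -/
def curvVec (γ : ℝ → ℝ → EuclideanSpace ℝ (Fin 3)) (u t : ℝ) : EuclideanSpace ℝ (Fin 3) :=
  pS γ (pS γ γ) u t + γ u t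

/-- A curve shortening flow `∂_t γ = ∂_s²γ + γ` of simple closed curves on the unit sphere
`S² ⊂ ℝ³`, defined for times `t` in the set `D` (each `γ(·,t)` is a `2π`-periodic regular
parametrisation, injective on a period, of a simple closed spherical curve `Γ_t`). -/
structure SphereCSF (D : Set ℝ) where
  γ : ℝ → ℝ → EuclideanSpace ℝ (Fin 3)
  smooth : ContDiffOn ℝ (⊤ : ℕ∞) (fun p : ℝ × ℝ => γ p.1 p.2) (Set.univ ×ˢ D)
  spherical : ∀ t ∈ D, ∀ u, ‖γ u t‖ = 1
  periodic : ∀ t ∈ D, Function.Periodic (fun u => γ u t) (2 * π)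
  regular : ∀ t ∈ D, ∀ u, deriv (fun v => γ v t) u ≠ 0
  simple : ∀ t ∈ D, Set.InjOn (fun u => γ u t) (Set.Ico 0 (2 * π))
  flow : ∀ t ∈ D, ∀ u, HasDerivWithinAt (fun s => γ u s) (curvVec γ u t) D t

variable {D : Set ℝ}

/-- The parametrisation speed `|∂_u γ|`. -/
def SphereCSF.speed (F : SphereCSF D) (u t : ℝ) : ℝ := ‖deriv (fun v => F.γ v t) u‖

/-- The total length `L(t)` of the curve `Γ_t`. -/
def SphereCSF.length (F : SphereCSF D) (t : ℝ) : ℝ := ∫ u in (0:ℝ)..(2 * π), F.speed u t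

/-- The length `ℓ` of the shorter of the two arcs of `Γ_t` joining `γ(u,t)` to `γ(v,t)`. -/
def SphereCSF.arcLen (F : SphereCSF D) (t u v : ℝ) : ℝ :=
  min |∫ w in u..v, F.speed w t| (F.length t - |∫ w in u..v, F.speed w t|)

/-- The Euclidean chord length `d` between `γ(u,t)` and `γ(v,t)`. -/
def SphereCSF.chord (F : SphereCSF D) (t u v : ℝ) : ℝ := ‖F.γ u t - F.γ v t‖

/-- The squared geodesic curvature `κ² = |∂_s²γ + γ|²`. -/
def SphereCSF.curvSq (F : SphereCSF D) (u t : ℝ) : ℝ := ‖curvVec F.γ u t‖ ^ 2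

/-- The rescaled time `τ(t) = ∫₀ᵗ L(s)⁻² ds`. -/
def SphereCSF.tau (F : SphereCSF D) (t : ℝ) : ℝ := ∫ s in (0:ℝ)..t, ((F.length s) ^ 2)⁻¹

lemma cos_le_quartic (x : ℝ) : cos x ≤ 1 - x ^ 2 / 2 + x ^ 4 / 24 := by
  wlog hx : 0 ≤ x generalizing x
  · have := this (-x) (by linarith)
    simpa [Even.neg_pow (by decide : Even 2), Even.neg_pow (by decide : Even 4)] using this
  have hd : ∀ y : ℝ, HasDerivAt (fun y : ℝ => 1 - y ^ 2 / 2 + y ^ 4 / 24 - cos y)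
      (sin y - (y - y ^ 3 / 6)) y := by
    intro y
    refine (((((hasDerivAt_pow 2 y).div_const 2).const_sub 1).add
      ((hasDerivAt_pow 4 y).div_const 24)).sub (hasDerivAt_cos y)).congr_deriv ?_
    norm_num
    ring
  have hm : MonotoneOn (fun y : ℝ => 1 - y ^ 2 / 2 + y ^ 4 / 24 - cos y) (Set.Ici 0) := by
    refine monotoneOn_of_hasDerivWithinAt_nonneg (convex_Ici 0)
      (fun y _ => (hd y).continuousAt.continuousWithinAt)
      (fun y _ => (hd y).hasDerivWithinAt) ?_
    intro y hy
    rw [interior_Ici] at hy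
    linarith [sin_ge_sub_cube (le_of_lt hy)]
  have := hm (Set.self_mem_Ici) hx hx
  simp at this
  linarith

lemma sq_lt_of_lt_pi_div_two {x : ℝ} (hx : 0 < x) (hx' : x < π / 2) : x ^ 2 < 2.4675 := by
  have := pi_lt_d4
  nlinarith

lemma mul_cos_le_sin_mul {x : ℝ} (hx : 0 < x) (hx' : x < π / 2) :
    x * cos x ≤ sin x * (1 - x ^ 2 / 3) := by
  have h1 := cos_le_quartic x
  have h2 := sin_ge_sub_cube hx.le
  have h3 := sq_lt_of_lt_pi_div_two hx hx'
  have h4 : 0 ≤ 1 - x ^ 2 / 3 := by linarith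
  calc x * cos x ≤ x * (1 - x ^ 2 / 2 + x ^ 4 / 24) := by gcongr
    _ ≤ (x - x ^ 3 / 6) * (1 - x ^ 2 / 3) := by
      have : 0 ≤ x * x ^ 4 := by positivity
      nlinarith
    _ ≤ sin x * (1 - x ^ 2 / 3) := by gcongr

lemma cos_mul_le_sin {x : ℝ} (hx : 0 < x) (hx' : x < π / 2) :
    x * cos x * (1 + x ^ 2 / 3 + x ^ 4 / 15) ≤ sin x := by
  have h1 := cos_le_quartic x
  have h2 := sin_ge_sub_cube hx.le
  have h3 := sq_lt_of_lt_pi_div_two hx hx'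
  calc x * cos x * (1 + x ^ 2 / 3 + x ^ 4 / 15)
      ≤ x * (1 - x ^ 2 / 2 + x ^ 4 / 24) * (1 + x ^ 2 / 3 + x ^ 4 / 15) := by gcongr
    _ ≤ x - x ^ 3 / 6 := by
      have h5 : (1 - x ^ 2 / 2 + x ^ 4 / 24) * (1 + x ^ 2 / 3 + x ^ 4 / 15) ≤ 1 - x ^ 2 / 6 := by
        generalize hq : x ^ 2 = q at *
        have h4 : x ^ 4 = q ^ 2 := by rw [← hq]; ring
        rw [h4]
        have hq0 : 0 ≤ q := by rw [← hq]; positivity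
        have : 0 ≤ q ^ 2 := by positivity
        have : 0 ≤ q ^ 3 := by positivity
        nlinarith
      nlinarith
    _ ≤ sin x := h2

lemma sq_le_sin_sq_mul {x : ℝ} (hx : 0 < x) (hx' : x < π / 2) :
    x ^ 2 ≤ sin x ^ 2 * (1 + x ^ 2 / 3 + 4 / 15 * x ^ 4) := by
  have h2 := sin_ge_sub_cube hx.le
  have h3 := sq_lt_of_lt_pi_div_two hx hx'
  have h4 : 0 ≤ x - x ^ 3 / 6 := by nlinarith
  calc x ^ 2 ≤ (x - x ^ 3 / 6) ^ 2 * (1 + x ^ 2 / 3 + 4 / 15 * x ^ 4) := by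
        have e : (x - x ^ 3 / 6) ^ 2 = x ^ 2 * (1 - x ^ 2 / 6) ^ 2 := by ring
        have h5 : 1 ≤ (1 - x ^ 2 / 6) ^ 2 * (1 + x ^ 2 / 3 + 4 / 15 * x ^ 4) := by
          generalize hq : x ^ 2 = q at *
          have h4 : x ^ 4 = q ^ 2 := by rw [← hq]; ring
          rw [h4]
          have hq0 : 0 ≤ q := by rw [← hq]; positivity
          have : 0 ≤ q ^ 2 * (33/180 - 43/540 * q + 1/135 * q ^ 2) := by
            apply mul_nonneg (by positivity)
            nlinarith
          nlinarith
        rw [e, mul_assoc]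
        exact le_mul_of_one_le_right (by positivity) h5
    _ ≤ _ := by gcongr

/-- The remainder `(1 - x cot x - x²/3) / x⁴` grows slowly. -/
lemma cot_remainder_sub_le {p q : ℝ} (hp : 0 < p) (hpq : p ≤ q) (hq : q < π / 2) :
    (1 - q * (cos q / sin q)) / q ^ 4 - 1 / (3 * q ^ 2)
      - ((1 - p * (cos p / sin p)) / p ^ 4 - 1 / (3 * p ^ 2))
      ≤ 2 / 15 * (q ^ 2 / p ^ 2 - 1) := by
  set f : ℝ → ℝ := fun x => 2 / 15 * (x ^ 2 / p ^ 2) -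
    ((1 - x * (cos x / sin x)) / x ^ 4 - 1 / (3 * x ^ 2)) with hf
  have hd : ∀ x ∈ Set.Icc p q, HasDerivAt f (4 / 15 * x / p ^ 2 -
      ((3 * x * (cos x / sin x) + x ^ 2 / sin x ^ 2 - 4 + 2 * x ^ 2 / 3) / x ^ 5)) x := by
    intro x hx
    have hx0 : 0 < x := hp.trans_le hx.1
    have hs : sin x ≠ 0 := (sin_pos_of_pos_of_lt_pi hx0 (by linarith [hx.2, pi_pos])).ne'
    have h1 := ((hasDerivAt_id x).mul ((hasDerivAt_cos x).div (hasDerivAt_sin x) hs)).const_sub 1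
    have h2 := h1.div (hasDerivAt_pow 4 x) (by positivity)
    have h3 := (hasDerivAt_const x (1:ℝ)).div ((hasDerivAt_pow 2 x).const_mul 3) (by positivity)
    have h4 := (((hasDerivAt_pow 2 x).div_const (p ^ 2)).const_mul (2/15)).sub (h2.sub h3)
    refine h4.congr_deriv ?_
    have hc : cos x ^ 2 = 1 - sin x ^ 2 := by rw [cos_sq']
    simp
    field_simp
    ring_nf
    rw [hc]
    ring
  have hm : MonotoneOn f (Set.Icc p q) := by
    refine monotoneOn_of_hasDerivWithinAt_nonneg (convex_Icc p q)
      (fun y hy => (hd y hy).continuousAt.continuousWithinAt)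
      (fun y hy => (hd y (interior_subset hy)).hasDerivWithinAt) ?_
    intro x hx
    replace hx := interior_subset hx
    have hx0 : 0 < x := hp.trans_le hx.1
    have hx2 : x < π / 2 := hx.2.trans_lt hq
    have hs : 0 < sin x := (sin_pos_of_pos_of_lt_pi hx0 (by linarith [pi_pos]))
    have h1 : x * (cos x / sin x) ≤ 1 - x ^ 2 / 3 := by
      rw [← mul_div_assoc, div_le_iff₀ hs]
      linarith [mul_cos_le_sin_mul hx0 hx2]
    have h2 : x ^ 2 / sin x ^ 2 ≤ 1 + x ^ 2 / 3 + 4 / 15 * x ^ 4 := by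
      rw [div_le_iff₀ (by positivity)]
      linarith [sq_le_sin_sq_mul hx0 hx2]
    have h3 : (3 * x * (cos x / sin x) + x ^ 2 / sin x ^ 2 - 4 + 2 * x ^ 2 / 3) / x ^ 5
        ≤ 4 / 15 / x := by
      rw [div_le_div_iff₀ (by positivity) hx0]
      nlinarith
    have h4 : 4 / 15 / x ≤ 4 / 15 * x / p ^ 2 := by
      rw [div_le_div_iff₀ hx0 (by positivity)]
      nlinarith [hx.1]
    linarith
  have := hm (Set.left_mem_Icc.2 hpq) (Set.right_mem_Icc.2 hpq) hpq
  simp only [hf] at this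
  rw [div_self (by positivity)] at this
  linarith

/-- Sign of the logarithmic factor in the derivative of the left side in
`mul_cos_mul_sin_sq_sub_le`. -/
lemma chord_factor_nonneg {p q : ℝ} (hp : 0 < p) (hpq : p ≤ q) (hq : q < π / 2) :
    0 ≤ (p ^ 2 / q ^ 2) ^ 2 * (q * (cos q / sin q)) - (1 - p ^ 2 / q ^ 2) * p ^ 2
      + 2 * (p ^ 2 / q ^ 2) * (1 - p ^ 2 / q ^ 2) * (sin q / cos q / q)
      + (1 - p ^ 2 / q ^ 2) ^ 2 - p * (cos p / sin p) := by
  have hq0 : 0 < q := hp.trans_le hpq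
  have hc : 0 < cos q := cos_pos_of_mem_Ioo ⟨by linarith, hq⟩
  have h1 := cot_remainder_sub_le hp hpq hq
  have h2 : 1 + q ^ 2 / 3 + q ^ 4 / 15 ≤ sin q / cos q / q := by
    rw [div_div, le_div_iff₀ (by positivity)]
    linarith [cos_mul_le_sin hq0 hq]
  have hr : p ^ 2 / q ^ 2 ≤ 1 := by
    rw [div_le_one (by positivity)]; gcongr
  have hr0 : 0 ≤ p ^ 2 / q ^ 2 := by positivity
  have h3 := mul_le_mul_of_nonneg_left h2
    (mul_nonneg (mul_nonneg zero_le_two hr0) (sub_nonneg.2 hr))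
  have h4 := mul_le_mul_of_nonneg_left h1 (by positivity : 0 ≤ p ^ 4)
  generalize cos q / sin q = u at *
  generalize cos p / sin p = v at *
  generalize sin q / cos q / q = w at *
  have e1 : p ^ 4 * ((1 - q * u) / q ^ 4 - 1 / (3 * q ^ 2) -
      ((1 - p * v) / p ^ 4 - 1 / (3 * p ^ 2))) =
      (p ^ 2 / q ^ 2) ^ 2 * (1 - q * u) - (p ^ 2 / q ^ 2) * p ^ 2 / 3 - (1 - p * v)
       + p ^ 2 / 3 := by
    field_simp
    ring
  have e2 : p ^ 4 * (2 / 15 * (q ^ 2 / p ^ 2 - 1)) = 2 / 15 * p ^ 2 * (q ^ 2 - p ^ 2) := by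
    field_simp
  have e3 : 2 * (p ^ 2 / q ^ 2) * (1 - p ^ 2 / q ^ 2) * (1 + q ^ 2 / 3 + q ^ 4 / 15)
      = 2 * (p ^ 2 / q ^ 2) * (1 - p ^ 2 / q ^ 2) + 2 / 3 * p ^ 2 * (1 - p ^ 2 / q ^ 2)
       + 2 / 15 * p ^ 2 * (q ^ 2 - p ^ 2) := by
    field_simp
  rw [e1, e2] at h4
  rw [e3] at h3
  nlinarith

lemma mul_cos_mul_sin_sq_sub_le {p q : ℝ} (hp : 0 < p) (hpq : p ≤ q) (hq : q < π / 2) :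
    p * cos p * (sin q ^ 2 - sin p ^ 2) * q ^ 4 ≤ sin p * (q ^ 2 - p ^ 2) *
      (q ^ 2 * p ^ 2 * cos q ^ 2 + (q ^ 2 - p ^ 2) * sin q ^ 2) := by
  have hq0 : 0 < q := hp.trans_le hpq
  have hsp : 0 < sin p := sin_pos_of_pos_of_lt_pi hp (by linarith)
  set k := p * (cos p / sin p) with hk
  set f : ℝ → ℝ := fun x => (1 - p ^ 2 / x ^ 2) * (p ^ 2 * cos x ^ 2) +
    (1 - p ^ 2 / x ^ 2) ^ 2 * sin x ^ 2 - k * (sin x ^ 2 - sin p ^ 2) with hf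
  have hd : ∀ x ∈ Set.Icc p q, HasDerivAt f (2 * (sin x * cos x) *
      ((p ^ 2 / x ^ 2) ^ 2 * (x * (cos x / sin x)) - (1 - p ^ 2 / x ^ 2) * p ^ 2
      + 2 * (p ^ 2 / x ^ 2) * (1 - p ^ 2 / x ^ 2) * (sin x / cos x / x)
      + (1 - p ^ 2 / x ^ 2) ^ 2 - k)) x := by
    intro x hx
    have hx0 : 0 < x := hp.trans_le hx.1
    have hs : sin x ≠ 0 := (sin_pos_of_pos_of_lt_pi hx0 (by linarith [hx.2, pi_pos])).ne'
    have hc : cos x ≠ 0 := (cos_pos_of_mem_Ioo ⟨by linarith, by linarith [hx.2]⟩).ne'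
    have h1 := ((hasDerivAt_const x (p ^ 2)).div (hasDerivAt_pow 2 x) (by positivity)).const_sub 1
    have h2 := h1.mul (((hasDerivAt_cos x).pow 2).const_mul (p ^ 2))
    have h3 := (h1.pow 2).mul ((hasDerivAt_sin x).pow 2)
    have h4 := (((hasDerivAt_sin x).pow 2).sub_const (sin p ^ 2)).const_mul k
    refine ((h2.add h3).sub h4).congr_deriv ?_
    simp
    field_simp
    ring
  have hm : MonotoneOn f (Set.Icc p q) := by
    refine monotoneOn_of_hasDerivWithinAt_nonneg (convex_Icc p q)
      (fun y hy => (hd y hy).continuousAt.continuousWithinAt)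
      (fun y hy => (hd y (interior_subset hy)).hasDerivWithinAt) ?_
    intro x hx
    replace hx := interior_subset hx
    have hx0 : 0 < x := hp.trans_le hx.1
    have hx2 : x < π / 2 := hx.2.trans_lt hq
    have hs : 0 < sin x := sin_pos_of_pos_of_lt_pi hx0 (by linarith [hx.2, pi_pos])
    have hc : 0 < cos x := cos_pos_of_mem_Ioo ⟨by linarith, by linarith [hx.2]⟩
    exact mul_nonneg (by positivity) (chord_factor_nonneg hp hx.1 hx2)
  have := hm (Set.left_mem_Icc.2 hpq) (Set.right_mem_Icc.2 hpq) hpq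
  simp only [hf] at this
  rw [div_self (by positivity)] at this
  have h5 := mul_le_mul_of_nonneg_left this (by positivity : 0 ≤ q ^ 4 * sin p)
  have e1 : q ^ 4 * sin p * ((1 - p ^ 2 / q ^ 2) * (p ^ 2 * cos q ^ 2) +
      (1 - p ^ 2 / q ^ 2) ^ 2 * sin q ^ 2 - k * (sin q ^ 2 - sin p ^ 2)) =
      sin p * (q ^ 2 - p ^ 2) *
      (q ^ 2 * p ^ 2 * cos q ^ 2 + (q ^ 2 - p ^ 2) * sin q ^ 2) -
      p * cos p * (sin q ^ 2 - sin p ^ 2) * q ^ 4 := by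
    rw [hk]
    field_simp
  rw [e1] at h5
  simp at h5
  linarith

lemma mul_arctan_le_arctan_mul {s X : ℝ} (hs : 0 ≤ s) (hs1 : s ≤ 1) (hX : 0 ≤ X) :
    s * arctan X ≤ arctan (s * X) := by
  have hd : ∀ x : ℝ, HasDerivAt (fun x => arctan (s * x) - s * arctan x)
      (1 / (1 + (s * x) ^ 2) * s - s * (1 / (1 + x ^ 2))) x := by
    intro x
    have h1 : HasDerivAt (fun x : ℝ => s * x) s x := by simpa using (hasDerivAt_id x).const_mul s
    exact h1.arctan.sub ((hasDerivAt_arctan x).const_mul s)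
  have hm : MonotoneOn (fun x => arctan (s * x) - s * arctan x) (Set.Ici 0) := by
    refine monotoneOn_of_hasDerivWithinAt_nonneg (convex_Ici 0)
      (fun y _ => (hd y).continuousAt.continuousWithinAt)
      (fun y _ => (hd y).hasDerivWithinAt) ?_
    intro x _
    have : 1 / (1 + x ^ 2) ≤ 1 / (1 + (s * x) ^ 2) := by
      apply one_div_le_one_div_of_le (by positivity)
      have : s ^ 2 ≤ 1 := by nlinarith
      nlinarith [sq_nonneg x]
    nlinarith
  have := hm (Set.self_mem_Ici) hX hX
  simp at this
  linarith

lemma tan_chord_bound {p q y : ℝ} (hp : 0 < p) (hpq : p < q) (hq : q < π / 2)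
    (hy : 0 < y) (hy' : y < π / 2) (h : tan p = tan q * sin y) :
    tan q * cos y ^ 2 * p * cos p ^ 2 / (q ^ 2 - p ^ 2)
      ≤ sin y + y * cos y * (tan q ^ 2 / q ^ 2 - 1) := by
  have hq0 : 0 < q := hp.trans hpq
  have hsy : 0 < sin y := sin_pos_of_pos_of_lt_pi hy (by linarith)
  have hcy : 0 < cos y := cos_pos_of_mem_Ioo ⟨by linarith, hy'⟩
  have hcq : 0 < cos q := cos_pos_of_mem_Ioo ⟨by linarith, hq⟩
  have hcp : 0 < cos p := cos_pos_of_mem_Ioo ⟨by linarith, by linarith⟩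
  have hX : 0 < tan q := tan_pos_of_pos_of_lt_pi_div_two hq0 hq
  have hqX : q ≤ tan q := le_tan hq0.le hq
  have hD : 0 < q ^ 2 - p ^ 2 := by nlinarith
  have hr : sin y ^ 2 ≤ p ^ 2 / q ^ 2 := by
    have h1 := mul_arctan_le_arctan_mul hsy.le (sin_le_one y) hX.le
    rw [mul_comm (sin y) (tan q), ← h, arctan_tan (by linarith) (by linarith),
      arctan_tan (by linarith) (by linarith)] at h1
    rw [← div_pow]
    gcongr
    rw [le_div_iff₀ hq0]
    exact h1
  have h1 := mul_cos_mul_sin_sq_sub_le hp hpq.le hq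
  have hE : sin q ^ 2 - sin p ^ 2 = cos p ^ 2 * cos q ^ 2 * (tan q ^ 2 * cos y ^ 2) := by
    have h2 : tan q ^ 2 * cos y ^ 2 = tan q ^ 2 - tan p ^ 2 := by
      rw [h, cos_sq' y]; ring
    rw [h2, tan_eq_sin_div_cos, tan_eq_sin_div_cos]
    field_simp
    rw [cos_sq' p, cos_sq' q]
    ring
  have hsp : sin p = tan q * sin y * cos p := by
    rw [← h, tan_mul_cos hcp.ne']
  have hsq : sin q = tan q * cos q := (tan_mul_cos hcq.ne').symm
  rw [hE, hsp, hsq] at h1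
  have hA : tan q * cos y ^ 2 * p * cos p ^ 2 / (q ^ 2 - p ^ 2) ≤
      sin y * (1 + (1 - p ^ 2 / q ^ 2) * (tan q ^ 2 / q ^ 2 - 1)) := by
    rw [div_le_iff₀ hD]
    have hpos : 0 < tan q * cos p * cos q ^ 2 * q ^ 4 := by positivity
    refine le_of_mul_le_mul_left ?_ hpos
    calc _ = p * cos p * (cos p ^ 2 * cos q ^ 2 * (tan q ^ 2 * cos y ^ 2)) * q ^ 4 := by ring
      _ ≤ _ := h1
      _ = _ := by field_simp; ring
  have hB : sin y * (1 - p ^ 2 / q ^ 2) ≤ y * cos y := by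
    calc sin y * (1 - p ^ 2 / q ^ 2) ≤ sin y * (1 - sin y ^ 2) := by gcongr
      _ = sin y * cos y * cos y := by rw [← cos_sq']; ring
      _ ≤ sin y * cos y * 1 := by gcongr; exact cos_le_one y
      _ ≤ y * cos y := by rw [mul_one]; gcongr; exact sin_le hy.le
  have hC : 0 ≤ tan q ^ 2 / q ^ 2 - 1 := by
    rw [sub_nonneg, le_div_iff₀ (by positivity), one_mul]; gcongr
  have := mul_le_mul_of_nonneg_right hB hC
  linarith

lemma sin_sub_mul_cos_nonneg {y : ℝ} (hy : 0 ≤ y) (hy' : y ≤ π / 2) : y * cos y ≤ sin y := by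
  rcases hy'.eq_or_lt with rfl | h
  · simp
  have hc : 0 < cos y := cos_pos_of_mem_Ioo ⟨by linarith [pi_pos], h⟩
  have := le_tan hy h
  rw [tan_eq_sin_div_cos, le_div_iff₀ hc] at this
  exact this

lemma arctan_pi_ratio {a y : ℝ} (ha : 0 < a) (hy : 0 < y) (hy' : y < π / 2) {l : ℝ}
    (hl : 0 ≤ l) (hl2 : l * (arctan (a / π) / a) ≤ 2) :
    1 - arctan (a / π * sin y) ^ 2 / arctan (a / π) ^ 2 ≤
      1 - (l * (arctan (a / π * sin y) / a)) ^ 2 / 4 := by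
  have hA : 0 < arctan (a / π) := arctan_pos.2 (by positivity)
  have hsy : 0 < sin y := sin_pos_of_pos_of_lt_pi hy (by linarith)
  have hB : 0 < arctan (a / π * sin y) := arctan_pos.2 (by positivity)
  have h1 : l / a ≤ 2 / arctan (a / π) := by
    rw [le_div_iff₀ hA]; calc _ = _ := by ring
      _ ≤ _ := hl2
  have h2 : (l / a) ^ 2 ≤ (2 / arctan (a / π)) ^ 2 := by gcongr
  have h3 := mul_le_mul_of_nonneg_right h2 (sq_nonneg (arctan (a / π * sin y)))
  have e1 : (l * (arctan (a / π * sin y) / a)) ^ 2 = (l / a) ^ 2 * arctan (a / π * sin y) ^ 2 := by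
    ring
  have e2 : arctan (a / π * sin y) ^ 2 / arctan (a / π) ^ 2 =
    (2 / arctan (a / π)) ^ 2 * arctan (a / π * sin y) ^ 2 / 4 := by ring
  rw [e1, e2]
  linarith

/-- The profile inequality used at a pair of points with parallel tangents. -/
lemma parallel_profile_nonneg {a y l : ℝ} (ha : 0 < a) (hy : 0 < y) (hy' : y < π / 2)
    (hl : 0 ≤ l) (hl2 : l * (arctan (a / π) / a) ≤ 2) :
    let φ := arctan (a / π * sin y) / a
    let r := 1 / (1 + (a / π * sin y) ^ 2)
    let c := 1 - (l * φ) ^ 2 / 4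
    0 < c ∧ 0 ≤ l ^ 2 * (y / π) * (cos y * r) - l ^ 2 * φ * (cos y * r) ^ 2 / c
      + 4 * π ^ 2 * (sin y / π * r - y / π * (cos y * r)) := by
  intro φ r c
  have hsy : 0 < sin y := sin_pos_of_pos_of_lt_pi hy (by linarith)
  have hsy1 : sin y < 1 := by
    rw [← sin_pi_div_two]
    exact sin_lt_sin_of_lt_of_le_pi_div_two (by linarith) le_rfl hy'
  have hcy : 0 < cos y := cos_pos_of_mem_Ioo ⟨by linarith, hy'⟩
  have hapi : 0 < a / π := by positivity
  set A := arctan (a / π) with hA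
  set θ := arctan (a / π * sin y) with hθ
  have hA0 : 0 < A := arctan_pos.2 hapi
  have hθ0 : 0 < θ := arctan_pos.2 (by positivity)
  have hθA : θ < A := arctan_strictMono (by nlinarith)
  have hA2 : A < π / 2 := arctan_lt_pi_div_two _
  have hr : r = cos θ ^ 2 := by rw [hθ, cos_sq_arctan]
  have hr0 : 0 < r := by positivity
  have htA : tan A = a / π := tan_arctan _
  have htθ : tan θ = tan A * sin y := by rw [htA, hθ, tan_arctan]
  have hc : 1 - θ ^ 2 / A ^ 2 ≤ c := arctan_pi_ratio ha hy hy' hl hl2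
  have hD : 0 < A ^ 2 - θ ^ 2 := by nlinarith
  have h1r : 0 < 1 - θ ^ 2 / A ^ 2 := by
    rw [sub_pos, div_lt_one (by positivity)]; linarith
  have hc0 : 0 < c := h1r.trans_le hc
  refine ⟨hc0, ?_⟩
  have hφ0 : 0 < φ := by positivity
  have hR : 0 ≤ 4 * π ^ 2 * (sin y / π * r - y / π * (cos y * r)) := by
    have := sin_sub_mul_cos_nonneg hy.le hy'.le
    have : sin y / π * r - y / π * (cos y * r) = (sin y - y * cos y) * r / π := by ring
    rw [this]
    have : 0 ≤ sin y - y * cos y := by linarith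
    positivity
  set K0 := y / π - φ * (cos y * r) / (1 - θ ^ 2 / A ^ 2) with hK0
  have hK : K0 ≤ y / π - φ * (cos y * r) / c := by
    rw [hK0]; gcongr
  have e : l ^ 2 * (y / π) * (cos y * r) - l ^ 2 * φ * (cos y * r) ^ 2 / c =
      l ^ 2 * (cos y * r) * (y / π - φ * (cos y * r) / c) := by ring
  rw [e]
  have hf : 0 ≤ l ^ 2 * (cos y * r) := by positivity
  have hK2 := mul_le_mul_of_nonneg_left hK hf
  rcases le_or_gt 0 K0 with h0 | h0
  · have := mul_nonneg hf h0
    linarith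
  have hl3 : l ≤ 2 * a / A := by
    rw [le_div_iff₀ hA0]
    have : l * A = l * (A / a) * a := by field_simp
    rw [this]; gcongr
  have hl4 : l ^ 2 ≤ (2 * a / A) ^ 2 := by gcongr
  have hK3 : (2 * a / A) ^ 2 * ((cos y * r) * K0) ≤ l ^ 2 * ((cos y * r) * K0) :=
    mul_le_mul_of_nonpos_right hl4 (mul_nonpos_of_nonneg_of_nonpos (by positivity) h0.le)
  have hm := tan_chord_bound hθ0 hθA hA2 hy hy' htθ
  rw [htA, ← hr] at hm
  have hfin : (2 * a / A) ^ 2 * ((cos y * r) * K0) +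
      4 * π ^ 2 * (sin y / π * r - y / π * (cos y * r)) = 4 * π * r *
      (sin y + y * cos y * ((a / π) ^ 2 / A ^ 2 - 1) -
      a / π * cos y ^ 2 * θ * r / (A ^ 2 - θ ^ 2)) := by
    have e3 : 1 - θ ^ 2 / A ^ 2 = (A ^ 2 - θ ^ 2) / A ^ 2 := by field_simp
    rw [hK0, e3]
    have hφ : φ = θ / a := rfl
    rw [hφ]
    field_simp
    ring
  have : 0 ≤ 4 * π * r * (sin y + y * cos y * ((a / π) ^ 2 / A ^ 2 - 1) -
      a / π * cos y ^ 2 * θ * r / (A ^ 2 - θ ^ 2)) :=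
    mul_nonneg (by positivity) (by linarith)
  linarith

lemma mul_sin_le_mul_sin {y α : ℝ} (hy : 0 < y) (h : y ≤ α) (hα : α ≤ π) :
    y * sin α ≤ α * sin y := by
  have := strictConcaveOn_sin_Icc.concaveOn.2 (Set.left_mem_Icc.2 pi_pos.le)
    (⟨by linarith, hα⟩ : α ∈ Set.Icc 0 π) (show 0 ≤ 1 - y / α by rw [sub_nonneg, div_le_one (by linarith)]; exact h)
    (show 0 ≤ y / α by have := hy.trans_le h; positivity)
    (by ring)
  have hα0 := hy.trans_le h
  simp at this
  rw [div_mul_cancel₀ _ hα0.ne', div_mul_eq_mul_div, div_le_iff₀ hα0] at this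
  linarith

lemma sq_add_le_sq_of_cos {y α : ℝ} (hy : 0 < y) (h : y ≤ α) (hα : α ≤ π) :
    2 * y * (cos y - cos α) ≤ (α ^ 2 - y ^ 2) * sin y := by
  have hd : ∀ x : ℝ, HasDerivAt (fun x => x ^ 2 * sin y + 2 * y * cos x)
      (2 * x * sin y + 2 * y * (- sin x)) x := by
    intro x
    refine (((hasDerivAt_pow 2 x).mul_const (sin y)).add
      ((hasDerivAt_cos x).const_mul (2 * y))).congr_deriv ?_
    simp
  have hm : MonotoneOn (fun x => x ^ 2 * sin y + 2 * y * cos x) (Set.Icc y α) := by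
    refine monotoneOn_of_hasDerivWithinAt_nonneg (convex_Icc y α)
      (fun y _ => (hd y).continuousAt.continuousWithinAt)
      (fun y _ => (hd y).hasDerivWithinAt) ?_
    intro x hx
    replace hx := interior_subset hx
    linarith [mul_sin_le_mul_sin hy hx.1 (hx.2.trans hα)]
  have := hm (Set.left_mem_Icc.2 h) (Set.right_mem_Icc.2 h) h
  simp at this
  linarith

/-- The profile inequality used at a pair of points with reflected tangents. -/
lemma reflected_profile_nonneg {a y α : ℝ} (ha : 0 < a) (hy : 0 < y) (hy' : y < π / 2)
    (hα0 : 0 ≤ α) (hα : α ≤ π) (h : cos α = cos y * (1 / (1 + (a / π * sin y) ^ 2))) :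
    let r := 1 / (1 + (a / π * sin y) ^ 2)
    0 ≤ 4 * (-π * sin y * r - 2 * (a ^ 2 / π) * sin y * cos y ^ 2 * r ^ 2)
      + 4 * π ^ 2 * (sin y / π * r - y / π * (cos y * r))
      + 4 * α ^ 2 * (cos y * r) / (y / π) := by
  intro r
  have hsy : 0 < sin y := sin_pos_of_pos_of_lt_pi hy (by linarith)
  have hcy : 0 < cos y := cos_pos_of_mem_Ioo ⟨by linarith, hy'⟩
  have hr0 : 0 < r := by positivity
  have hden : r * (1 + (a / π * sin y) ^ 2) = 1 := by
    simp only [r]; field_simp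
  have hr1 : r ≤ 1 := by nlinarith [sq_nonneg (a / π * sin y)]
  have hyα : y ≤ α := by
    by_contra hlt
    have := cos_lt_cos_of_nonneg_of_le_pi hα0 (by linarith) (not_le.1 hlt)
    rw [h] at this
    change cos y < cos y * r at this
    nlinarith
  have h1 := sq_add_le_sq_of_cos hy hyα hα
  rw [h] at h1
  change 2 * y * (cos y - cos y * r) ≤ _ at h1
  have e : 4 * (-π * sin y * r - 2 * (a ^ 2 / π) * sin y * cos y ^ 2 * r ^ 2)
      + 4 * π ^ 2 * (sin y / π * r - y / π * (cos y * r))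
      + 4 * α ^ 2 * (cos y * r) / (y / π) = 4 * π * (cos y * r) / (y * sin y) *
      ((α ^ 2 - y ^ 2) * sin y - 2 * y * (cos y * (r * (1 + (a / π * sin y) ^ 2) - r))) := by
    field_simp
    ring
  rw [e, hden]
  exact mul_nonneg (by positivity) (by linarith)

/-- Poincaré's inequality with Dirichlet boundary values below the first eigenvalue. -/
lemma dirichlet_poincare_of_lt {E : Type*} [NormedAddCommGroup E] [InnerProductSpace ℝ E]
    {V V' : ℝ → E} (hV : ∀ x, HasDerivAt V (V' x) x) (hV' : Continuous V') {p q k : ℝ}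
    (hpq : p ≤ q) (hp : V p = 0) (hq : V q = 0) (hk : 0 ≤ k) (hkpq : k * (q - p) < π) :
    k ^ 2 * ∫ x in p..q, ‖V x‖ ^ 2 ≤ ∫ x in p..q, ‖V' x‖ ^ 2 := by
  have hVc : Continuous V := continuous_iff_continuousAt.2 fun x => (hV x).continuousAt
  set m := (p + q) / 2 with hm
  have hcos : ∀ x ∈ Set.Icc p q, 0 < Real.cos (k * (x - m)) := by
    intro x hx
    apply Real.cos_pos_of_mem_Ioo
    have h1 : k * (x - m) ≤ k * ((q - p) / 2) := by
      apply mul_le_mul_of_nonneg_left _ hk; rw [hm]; linarith [hx.2]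
    have h2 : k * (-((q - p) / 2)) ≤ k * (x - m) := by
      apply mul_le_mul_of_nonneg_left _ hk; rw [hm]; linarith [hx.1]
    constructor <;> linarith
  have hd : ∀ x ∈ Set.Icc p q, HasDerivAt (fun x => -(k * Real.tan (k * (x - m)) * ‖V x‖ ^ 2))
      (-(k * (1 / Real.cos (k * (x - m)) ^ 2 * k) * ‖V x‖ ^ 2 +
        k * Real.tan (k * (x - m)) * (2 * inner ℝ (V x) (V' x)))) x := by
    intro x hx
    have h1 : HasDerivAt (fun x : ℝ => k * (x - m)) k x := by
      simpa using ((hasDerivAt_id x).sub_const m).const_mul k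
    have h2 := (Real.hasDerivAt_tan (hcos x hx).ne').comp x h1
    exact ((h2.const_mul k).mul (hV x).norm_sq).neg
  have key := intervalIntegral.sub_le_integral_of_hasDeriv_right_of_le hpq
    (g := fun x => -(k * Real.tan (k * (x - m)) * ‖V x‖ ^ 2))
    (φ := fun x => ‖V' x‖ ^ 2 - k ^ 2 * ‖V x‖ ^ 2)
    (fun x hx => (hd x hx).continuousAt.continuousWithinAt)
    (fun x hx => (hd x (Set.Ioo_subset_Icc_self hx)).hasDerivWithinAt)
    (by apply Continuous.integrableOn_Icc; fun_prop)
    (by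
      intro x hx
      have hc := hcos x (Set.Ioo_subset_Icc_self hx)
      have h1 : 1 / Real.cos (k * (x - m)) ^ 2 = 1 + Real.tan (k * (x - m)) ^ 2 := by
        rw [Real.tan_eq_sin_div_cos]; field_simp
        linarith [Real.sin_sq_add_cos_sq (k * (x - m))]
      have h2 := norm_add_sq_real (V' x) ((k * Real.tan (k * (x - m))) • V x)
      rw [norm_smul, mul_pow, inner_smul_right, Real.norm_eq_abs, sq_abs,
        real_inner_comm] at h2
      rw [h1]
      nlinarith [sq_nonneg ‖V' x + (k * Real.tan (k * (x - m))) • V x‖])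
  simp only [hp, hq, norm_zero] at key
  rw [intervalIntegral.integral_sub (by apply Continuous.intervalIntegrable; fun_prop)
    (by apply Continuous.intervalIntegrable; fun_prop), intervalIntegral.integral_const_mul] at key
  linarith

lemma dirichlet_poincare {E : Type*} [NormedAddCommGroup E] [InnerProductSpace ℝ E]
    {V V' : ℝ → E} (hV : ∀ x, HasDerivAt V (V' x) x) (hV' : Continuous V') {p q k : ℝ}
    (hpq : p < q) (hp : V p = 0) (hq : V q = 0) (hk : 0 < k) (hkpq : k * (q - p) ≤ π) :
    k ^ 2 * ∫ x in p..q, ‖V x‖ ^ 2 ≤ ∫ x in p..q, ‖V' x‖ ^ 2 := by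
  have hlim : Filter.Tendsto (fun k' : ℝ => k' ^ 2 * ∫ x in p..q, ‖V x‖ ^ 2) (nhdsWithin k (Set.Iio k))
      (nhds (k ^ 2 * ∫ x in p..q, ‖V x‖ ^ 2)) :=
    (Continuous.tendsto (by fun_prop) k).mono_left nhdsWithin_le_nhds
  refine le_of_tendsto hlim ?_
  filter_upwards [Ioo_mem_nhdsLT hk] with k' hk'
  refine dirichlet_poincare_of_lt hV hV' hpq.le hp hq hk'.1.le ?_
  nlinarith [hk'.2, sub_pos.2 hpq]

/-- Wirtinger's inequality. -/
lemma wirtinger {f f' : ℝ → ℝ} {L : ℝ} (hL : 0 < L) (hf : ∀ x, HasDerivAt f (f' x) x)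
    (hf' : Continuous f') (hper : Function.Periodic f L) (hper' : Function.Periodic f' L)
    (hmean : ∫ x in (0:ℝ)..L, f x = 0) :
    (2 * π / L) ^ 2 * ∫ x in (0:ℝ)..L, f x ^ 2 ≤ ∫ x in (0:ℝ)..L, f' x ^ 2 := by
  have hfc : Continuous f := continuous_iff_continuousAt.2 fun x => (hf x).continuousAt
  obtain ⟨s, hs⟩ : ∃ s, f (s + L / 2) - f s = 0 := by
    have hc : Continuous fun s => f (s + L / 2) - f s := by fun_prop
    have h2 : f (L / 2 + L / 2) = f 0 := by
      have := hper 0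
      rw [← this]; congr 1; ring
    rcases le_total (f (0 + L / 2) - f 0) 0 with h | h
    · exact mem_range_of_exists_le_of_exists_ge hc ⟨0, h⟩ ⟨L / 2, by rw [h2]; simp at h; linarith⟩
    · exact mem_range_of_exists_le_of_exists_ge hc ⟨L / 2, by rw [h2]; simp at h; linarith⟩ ⟨0, h⟩
  have hs1 : f (s + L / 2) = f s := by linarith
  have hV : ∀ x, HasDerivAt (fun x => f x - f s) (f' x) x := fun x => (hf x).sub_const _
  have k1 : 2 * π / L * (s + L / 2 - s) ≤ π := by
    apply le_of_eq; field_simp; ring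
  have k2 : 2 * π / L * (s + L - (s + L / 2)) ≤ π := by
    apply le_of_eq; field_simp; ring
  have e1 := dirichlet_poincare hV hf' (p := s) (q := s + L / 2) (by linarith) (by simp)
    (by simp [hs1]) (by positivity) k1
  have e2 := dirichlet_poincare hV hf' (p := s + L / 2) (q := s + L) (by linarith) (by simp [hs1])
    (by simp [hper s]) (by positivity) k2
  have i1 : ∀ a b, IntervalIntegrable (fun x => ‖f x - f s‖ ^ 2) volume a b := fun a b => by
    apply Continuous.intervalIntegrable; fun_prop
  have i2 : ∀ a b, IntervalIntegrable (fun x => ‖f' x‖ ^ 2) volume a b := fun a b => by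
    apply Continuous.intervalIntegrable; fun_prop
  have e3 := add_le_add e1 e2
  rw [← mul_add, intervalIntegral.integral_add_adjacent_intervals (i1 _ _) (i1 _ _),
    intervalIntegral.integral_add_adjacent_intervals (i2 _ _) (i2 _ _)] at e3
  have p1 : Function.Periodic (fun x => ‖f x - f s‖ ^ 2) L := fun x => by simp [hper x]
  have p2 : Function.Periodic (fun x => ‖f' x‖ ^ 2) L := fun x => by simp [hper' x]
  rw [p1.intervalIntegral_add_eq s 0, p2.intervalIntegral_add_eq s 0, zero_add] at e3
  simp only [Real.norm_eq_abs, sq_abs] at e3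
  refine le_trans (mul_le_mul_of_nonneg_left ?_ (by positivity)) e3
  have h1 : (fun x => (f x - f s) ^ 2) = fun x => (f x ^ 2 - (2 * f s) * f x) + f s ^ 2 := by
    ext x; ring
  rw [h1, intervalIntegral.integral_add, intervalIntegral.integral_sub,
    intervalIntegral.integral_const_mul, hmean]
  · simp only [intervalIntegral.integral_const, smul_eq_mul]
    have := mul_nonneg (sub_nonneg.2 hL.le) (sq_nonneg (f s))
    linarith
  all_goals (apply Continuous.intervalIntegrable; fun_prop)

lemma hasDerivAt_coord {f : ℝ → EuclideanSpace ℝ (Fin 3)} {f' : EuclideanSpace ℝ (Fin 3)} {x : ℝ}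
    (h : HasDerivAt f f' x) (i : Fin 3) : HasDerivAt (fun x => f x i) (f' i) x := by
  have := (EuclideanSpace.proj (𝕜 := ℝ) (i : Fin 3) : EuclideanSpace ℝ (Fin 3) →L[ℝ] ℝ).hasFDerivAt.comp_hasDerivAt x h
  exact this

/-- Fenchel's inequality in integrated form: a closed unit-speed curve of length `L` has
`∫ ‖c''‖² ≥ 4π²/L`. -/
lemma fenchel_sq {c c1 c2 : ℝ → EuclideanSpace ℝ (Fin 3)} {L : ℝ} (hL : 0 < L)
    (hc : ∀ x, HasDerivAt c (c1 x) x) (hc1 : ∀ x, HasDerivAt c1 (c2 x) x) (hc2 : Continuous c2)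
    (n1 : ∀ x, ‖c1 x‖ = 1) (per : Function.Periodic c L) (per1 : Function.Periodic c1 L)
    (per2 : Function.Periodic c2 L) :
    4 * π ^ 2 / L ≤ ∫ x in (0:ℝ)..L, ‖c2 x‖ ^ 2 := by
  have hc1c : Continuous c1 := continuous_iff_continuousAt.2 fun x => (hc1 x).continuousAt
  have hw : ∀ i : Fin 3, (2 * π / L) ^ 2 * ∫ x in (0:ℝ)..L, (c1 x i) ^ 2 ≤
      ∫ x in (0:ℝ)..L, (c2 x i) ^ 2 := by
    intro i
    apply wirtinger hL (fun x => hasDerivAt_coord (hc1 x) i) (by fun_prop)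
      (fun x => by simp [per1 x]) (fun x => by simp [per2 x])
    rw [intervalIntegral.integral_eq_sub_of_hasDerivAt (fun x _ => hasDerivAt_coord (hc x) i)
      (by apply Continuous.intervalIntegrable; fun_prop)]
    have := per 0
    rw [zero_add] at this
    simp [this]
  have h1 : ∀ g : ℝ → EuclideanSpace ℝ (Fin 3), Continuous g →
      ∫ x in (0:ℝ)..L, ‖g x‖ ^ 2 = ∑ i, ∫ x in (0:ℝ)..L, (g x i) ^ 2 := by
    intro g hg
    rw [← intervalIntegral.integral_finsetSum]
    · simp_rw [EuclideanSpace.real_norm_sq_eq]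
    · intro i _; apply Continuous.intervalIntegrable; fun_prop
  rw [h1 c2 hc2]
  have h2 := h1 c1 hc1c
  simp only [n1, intervalIntegral.integral_const, smul_eq_mul] at h2
  calc 4 * π ^ 2 / L = (2 * π / L) ^ 2 * ∑ i, ∫ x in (0:ℝ)..L, (c1 x i) ^ 2 := by
        rw [← h2]; field_simp; ring
    _ ≤ _ := by rw [Finset.mul_sum]; exact Finset.sum_le_sum fun i _ => hw i

/-- The bending energy of an arc whose end tangents make the angle `2α`. -/
lemma arc_bending_bound {c1 c2 : ℝ → EuclideanSpace ℝ (Fin 3)} {s1 s2 α : ℝ} (hs : s1 < s2)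
    (hc1 : ∀ x, HasDerivAt c1 (c2 x) x) (hc2 : Continuous c2)
    (n1 : ∀ x, ‖c1 x‖ = 1) (hα0 : 0 < α) (hα : α < π / 2)
    (hp : inner ℝ (c1 s1) (c1 s2) = Real.cos (2 * α)) :
    4 * α ^ 2 / (s2 - s1) ≤ ∫ x in s1..s2, ‖c2 x‖ ^ 2 := by
  have hc1c : Continuous c1 := continuous_iff_continuousAt.2 fun x => (hc1 x).continuousAt
  have hs0 : 0 < s2 - s1 := sub_pos.2 hs
  set k := 2 * α / (s2 - s1) with hk
  set m := (s1 + s2) / 2 with hm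
  have hC : 0 < Real.cos α := Real.cos_pos_of_mem_Ioo ⟨by linarith [pi_pos], hα⟩
  have hS : 0 < Real.sin α := Real.sin_pos_of_pos_of_lt_pi hα0 (by linarith [pi_pos])
  set b : EuclideanSpace ℝ (Fin 3) := (2 * Real.cos α)⁻¹ • (c1 s1 + c1 s2) with hb
  set e : EuclideanSpace ℝ (Fin 3) := (2 * Real.sin α)⁻¹ • (c1 s2 - c1 s1) with he
  have k1 : k * (s1 - m) = -α := by rw [hk, hm]; field_simp; ring
  have k2 : k * (s2 - m) = α := by rw [hk, hm]; field_simp; ring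
  set R : ℝ → EuclideanSpace ℝ (Fin 3) := fun x => Real.cos (k * (x - m)) • b + Real.sin (k * (x - m)) • e with hR
  set R1 : ℝ → EuclideanSpace ℝ (Fin 3) := fun x => (-Real.sin (k * (x - m)) * k) • b + (Real.cos (k * (x - m)) * k) • e with hR1
  have hlin : ∀ x : ℝ, HasDerivAt (fun x : ℝ => k * (x - m)) k x := fun x => by
    simpa using ((hasDerivAt_id x).sub_const m).const_mul k
  have dR : ∀ x, HasDerivAt R (R1 x) x := fun x =>
    ((hlin x).cos.smul_const b).add ((hlin x).sin.smul_const e)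
  have dR1 : ∀ x, HasDerivAt R1 (-(k ^ 2) • R x) x := by
    intro x
    refine ((((hlin x).sin.neg.mul_const k).smul_const b).add
      (((hlin x).cos.mul_const k).smul_const e)).congr_deriv ?_
    simp only [hR]; module
  have Rs1 : R s1 = c1 s1 := by
    simp only [hR, k1, Real.cos_neg, Real.sin_neg, hb, he, smul_smul]
    rw [show Real.cos α * (2 * Real.cos α)⁻¹ = 1/2 by field_simp,
      show -Real.sin α * (2 * Real.sin α)⁻¹ = -(1/2) by field_simp]
    module
  have Rs2 : R s2 = c1 s2 := by
    simp only [hR, k2, hb, he, smul_smul]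
    rw [show Real.cos α * (2 * Real.cos α)⁻¹ = 1/2 by field_simp,
      show Real.sin α * (2 * Real.sin α)⁻¹ = (1/2) by field_simp]
    module
  have nn : ∀ x, inner ℝ (c1 x) (c1 x) = (1:ℝ) := fun x => by
    rw [real_inner_self_eq_norm_sq, n1]; norm_num
  have hcos2 := Real.cos_two_mul α
  have hsc := Real.sin_sq_add_cos_sq α
  have hp' : inner ℝ (c1 s2) (c1 s1) = Real.cos (2 * α) := by rw [real_inner_comm]; exact hp
  have bb : inner ℝ b b = (1:ℝ) := by
    rw [hb, inner_smul_left, inner_smul_right, inner_add_add_self, nn, nn, hp, hp', hcos2]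
    simp; field_simp; ring
  have ee : inner ℝ e e = (1:ℝ) := by
    rw [he, inner_smul_left, inner_smul_right, inner_sub_sub_self, nn, nn, hp, hp', hcos2]
    simp; field_simp; linear_combination -4 * hsc
  have be : inner ℝ b e = (0:ℝ) := by
    rw [he, hb, inner_smul_left, inner_smul_right, inner_add_left, inner_sub_right, inner_sub_right,
      nn, nn, hp, hp']
    simp
  have eb : inner ℝ e b = (0:ℝ) := by rw [real_inner_comm]; exact be
  have nR : ∀ x, ‖R x‖ ^ 2 = 1 := by
    intro x
    rw [← real_inner_self_eq_norm_sq]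
    simp only [hR, inner_add_left, inner_add_right, inner_smul_left, inner_smul_right, bb, ee, be, eb]
    simp; linarith [Real.sin_sq_add_cos_sq (k * (x - m))]
  have nR1 : ∀ x, ‖R1 x‖ ^ 2 = k ^ 2 := by
    intro x
    rw [← real_inner_self_eq_norm_sq]
    simp only [hR1, inner_add_left, inner_add_right, inner_smul_left, inner_smul_right, bb, ee, be, eb]
    simp; linear_combination k ^ 2 * Real.sin_sq_add_cos_sq (k * (x - m))
  have RR1 : ∀ x, inner ℝ (R x) (R1 x) = 0 := by
    intro x
    simp only [hR, hR1, inner_add_left, inner_add_right, inner_smul_left, inner_smul_right, bb, ee, be, eb]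
    simp; ring
  have R1c : Continuous R1 := continuous_iff_continuousAt.2 fun x => (dR1 x).continuousAt
  have Rc : Continuous R := continuous_iff_continuousAt.2 fun x => (dR x).continuousAt
  have main := dirichlet_poincare_of_lt (V := fun x => c1 x - R x) (V' := fun x => c2 x - R1 x)
    (k := k) (fun x => (hc1 x).sub (dR x)) (hc2.sub R1c) hs.le (by simp [Rs1]) (by simp [Rs2])
    (by positivity) (by rw [hk]; field_simp; linarith)
  have dI : ∀ x, HasDerivAt (fun x => inner ℝ (c1 x) (R1 x))
      (inner ℝ (c1 x) (-(k ^ 2) • R x) + inner ℝ (c2 x) (R1 x)) x :=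
    fun x => (hc1 x).inner ℝ (dR1 x)
  have I1 : (∫ x in s1..s2, (inner ℝ (c1 x) (-(k ^ 2) • R x) + inner ℝ (c2 x) (R1 x))) = 0 := by
    rw [intervalIntegral.integral_eq_sub_of_hasDerivAt (fun x _ => dI x)
      (by apply Continuous.intervalIntegrable; fun_prop), ← Rs1, ← Rs2, RR1, RR1, sub_zero]
  rw [← intervalIntegral.integral_const_mul, ← sub_nonneg, ← intervalIntegral.integral_sub
    (by apply Continuous.intervalIntegrable; fun_prop)
    (by apply Continuous.intervalIntegrable; fun_prop)] at main
  have hid : ∀ x, ‖c2 x - R1 x‖ ^ 2 - k ^ 2 * ‖c1 x - R x‖ ^ 2 = (‖c2 x‖ ^ 2 - k ^ 2) -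
      2 * (inner ℝ (c1 x) (-(k ^ 2) • R x) + inner ℝ (c2 x) (R1 x)) := by
    intro x
    rw [norm_sub_sq_real, norm_sub_sq_real, nR, nR1, n1, inner_smul_right]; ring
  simp_rw [hid] at main
  rw [intervalIntegral.integral_sub (by apply Continuous.intervalIntegrable; fun_prop)
    (by apply Continuous.intervalIntegrable; fun_prop), intervalIntegral.integral_const_mul, I1,
    intervalIntegral.integral_sub (by apply Continuous.intervalIntegrable; fun_prop)
    (by apply Continuous.intervalIntegrable; fun_prop)] at main
  simp only [intervalIntegral.integral_const, smul_eq_mul] at main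
  have : (s2 - s1) * k ^ 2 = 4 * α ^ 2 / (s2 - s1) := by rw [hk]; field_simp; ring
  linarith

/-- The factor `(1 + (a/π)² sin² πz)⁻¹`. -/
def profR (a z : ℝ) : ℝ := 1 / (1 + (a / π * Real.sin (π * z)) ^ 2)

/-- The chord-arc profile `a⁻¹ arctan ((a/π) sin πz)`. -/
def prof (a z : ℝ) : ℝ := Real.arctan (a / π * Real.sin (π * z)) / a

/-- First derivative of the profile. -/
def prof' (a z : ℝ) : ℝ := Real.cos (π * z) * profR a z

/-- Second derivative of the profile. -/
def prof'' (a z : ℝ) : ℝ := -π * Real.sin (π * z) * profR a z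
  - 2 * (a ^ 2 / π) * Real.sin (π * z) * Real.cos (π * z) ^ 2 * profR a z ^ 2

lemma profR_pos (a z : ℝ) : 0 < profR a z := by unfold profR; positivity

lemma hasDerivAt_prof {a : ℝ} (ha : 0 < a) (z : ℝ) : HasDerivAt (prof a) (prof' a z) z := by
  have h1 : HasDerivAt (fun z : ℝ => π * z) π z := by simpa using (hasDerivAt_id z).const_mul π
  refine (((h1.sin.const_mul (a / π)).arctan).div_const a).congr_deriv ?_
  unfold prof' profR; field_simp

lemma hasDerivAt_prof' (a z : ℝ) : HasDerivAt (prof' a) (prof'' a z) z := by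
  have h1 : HasDerivAt (fun z : ℝ => π * z) π z := by simpa using (hasDerivAt_id z).const_mul π
  have h2 : (1 + (a / π * Real.sin (π * z)) ^ 2) ≠ 0 := by positivity
  refine (h1.cos.mul (((hasDerivAt_const z (1:ℝ))).div
    ((((h1.sin.const_mul (a / π)).pow 2)).const_add 1) h2)).congr_deriv ?_
  unfold prof'' profR
  dsimp only [Pi.pow_apply, Pi.div_apply]
  generalize hs : Real.sin (π * z) = s at *
  generalize Real.cos (π * z) = t at *
  field_simp
  simp
  field_simp
  ring

lemma prof_one_sub (a z : ℝ) : prof a (1 - z) = prof a z := by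
  unfold prof
  rw [mul_sub, mul_one, Real.sin_pi_sub]

lemma profR_one_sub (a z : ℝ) : profR a (1 - z) = profR a z := by
  unfold profR
  rw [mul_sub, mul_one, Real.sin_pi_sub]

lemma prof'_one_sub (a z : ℝ) : prof' a (1 - z) = -prof' a z := by
  unfold prof'
  rw [profR_one_sub, mul_sub, mul_one, Real.cos_pi_sub]; ring

lemma prof_zero (a : ℝ) : prof a 0 = 0 := by simp [prof]
lemma prof_one (a : ℝ) : prof a 1 = 0 := by simp [prof]
lemma prof_half (a : ℝ) : prof a (1 / 2) = Real.arctan (a / π) / a := by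
  unfold prof; rw [show π * (1 / 2) = π / 2 by ring]; simp
lemma prof_pos {a z : ℝ} (ha : 0 < a) (h0 : 0 < z) (h1 : z < 1) : 0 < prof a z := by
  have := Real.sin_pos_of_pos_of_lt_pi (x := π * z) (by positivity) (by nlinarith [pi_pos])
  unfold prof
  have h2 : 0 < Real.arctan (a / π * Real.sin (π * z)) := by
    rw [← Real.arctan_zero]; exact Real.arctan_strictMono (by positivity)
  positivity
lemma prof_le_half {a : ℝ} (ha : 0 < a) (z : ℝ) : prof a z ≤ Real.arctan (a / π) / a := by
  unfold prof
  gcongr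
  have : 0 < a / π := by positivity
  nlinarith [Real.sin_le_one (π * z)]

/-- The second-order necessary condition at a local minimum. -/
lemma IsLocalMin.second_deriv_nonneg {f f' : ℝ → ℝ} {f'' x : ℝ} (hmin : IsLocalMin f x)
    (hf : ∀ y, HasDerivAt f (f' y) y) (hf' : HasDerivAt f' f'' x) : 0 ≤ f'' := by
  by_contra! hneg
  have hd : deriv f = f' := funext fun y => (hf y).deriv
  have h0 : f' x = 0 := hmin.hasDerivAt_eq_zero (hf x)
  have hmax : IsLocalMax f x := by
    apply isLocalMax_of_deriv_deriv_neg
    · rw [hd, hf'.deriv]; exact hneg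
    · rw [hd, h0]
    · exact (hf x).continuousAt
  have hconst : ∀ᶠ y in nhds x, f y = f x := by
    filter_upwards [hmin, hmax] with y h1 h2 using le_antisymm h2 h1
  have h1 : f' =ᶠ[nhds x] fun _ => 0 := by
    filter_upwards [hconst.eventually_nhds] with y hy
    have : HasDerivAt f 0 y := ((hasDerivAt_const y (f x)).congr_of_eventuallyEq hy)
    exact (hf y).unique this
  have := hf'.unique ((hasDerivAt_const x (0:ℝ)).congr_of_eventuallyEq h1)
  linarith

/-- The Gram determinant relation for two points of the sphere with unit tangent vectors. -/
lemma gram_relation {x y T1 T2 : EuclideanSpace ℝ (Fin 3)} {d q : ℝ} (hd : d ≠ 0)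
    (hx : ‖x‖ = 1) (hy : ‖y‖ = 1) (hT1 : ‖T1‖ = 1) (hT2 : ‖T2‖ = 1) (hxy : ‖y - x‖ = d)
    (xT1 : inner ℝ x T1 = 0) (yT2 : inner ℝ y T2 = 0)
    (h1 : inner ℝ (y - x) T1 = d * q) (h2 : inner ℝ (y - x) T2 = d * q) :
    (inner ℝ T1 T2 - (2 * q ^ 2 - 1)) *
      ((1 - d ^ 2 / 4) * (inner ℝ T1 T2 - 1) + d ^ 2 / 2 * q ^ 2) = 0 := by
  set p := inner ℝ T1 T2 with hp
  have he : inner ℝ x y = 1 - d ^ 2 / 2 := by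
    have := norm_sub_sq_real y x
    rw [hxy, hx, hy, real_inner_comm] at this; linarith
  rw [inner_sub_left] at h1 h2
  have yT1 : inner ℝ y T1 = d * q := by linarith
  have xT2 : inner ℝ x T2 = -(d * q) := by linarith
  let vv : Fin 4 → EuclideanSpace ℝ (Fin 3) := ![x, y, T1, T2]
  have hdep : ¬ LinearIndependent ℝ vv := by
    intro h
    have := h.fintype_card_le_finrank
    simp at this
  obtain ⟨g, hg, i, hi⟩ := Fintype.not_linearIndependent_iff.1 hdep
  have nn : ∀ w : EuclideanSpace ℝ (Fin 3), ‖w‖ = 1 → inner ℝ w w = (1:ℝ) := fun w hw => by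
    rw [real_inner_self_eq_norm_sq, hw]; norm_num
  let G : Matrix (Fin 4) (Fin 4) ℝ := !![1, 1 - d ^ 2 / 2, 0, -(d * q);
    1 - d ^ 2 / 2, 1, d * q, 0; 0, d * q, 1, p; -(d * q), 0, p, 1]
  have hdet : G.det = 0 := by
    rw [← Matrix.exists_mulVec_eq_zero_iff]
    refine ⟨g, fun h => hi (by simp [h]), ?_⟩
    have hin : ∀ w, inner ℝ w (∑ i, g i • vv i) = 0 := fun w => by rw [hg, inner_zero_right]
    have ex : ∀ w, g 0 * inner ℝ w x + g 1 * inner ℝ w y + g 2 * inner ℝ w T1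
        + g 3 * inner ℝ w T2 = 0 := by
      intro w
      have := hin w
      simpa [Fin.sum_univ_four, vv, inner_add_right, inner_smul_right] using this
    ext j
    have hx' := ex x
    have hy' := ex y
    have h1' := ex T1
    have h2' := ex T2
    rw [nn _ hx, he, xT1, xT2] at hx'
    rw [nn _ hy, real_inner_comm, he, yT1, yT2] at hy'
    rw [nn _ hT1, real_inner_comm, xT1, real_inner_comm, yT1, ← hp] at h1'
    rw [nn _ hT2, real_inner_comm, xT2, real_inner_comm, yT2, real_inner_comm, ← hp] at h2'
    fin_cases j <;> simp [G, Matrix.mulVec, dotProduct, Fin.sum_univ_four] <;> linarith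
  have hd2 : d ^ 2 * ((p - (2 * q ^ 2 - 1)) *
      ((1 - d ^ 2 / 4) * (p - 1) + d ^ 2 / 2 * q ^ 2)) = 0 := by
    have : G.det = -(d ^ 2 * ((p - (2 * q ^ 2 - 1)) *
      ((1 - d ^ 2 / 4) * (p - 1) + d ^ 2 / 2 * q ^ 2))) := by
      simp [G, Matrix.det_succ_row_zero, Fin.sum_univ_succ, Fin.succAbove]
      ring
    linarith
  exact (mul_eq_zero.1 hd2).resolve_left (by positivity)

lemma sq_slope_le {x y T1 : EuclideanSpace ℝ (Fin 3)} {d q : ℝ} (hd : d ≠ 0)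
    (hx : ‖x‖ = 1) (hy : ‖y‖ = 1) (hT1 : ‖T1‖ = 1) (hxy : ‖y - x‖ = d)
    (xT1 : inner ℝ x T1 = 0) (h1 : inner ℝ (y - x) T1 = d * q) :
    q ^ 2 ≤ 1 - d ^ 2 / 4 := by
  have he : inner ℝ (y - x) x = - d ^ 2 / 2 := by
    have := norm_sub_sq_real y x
    rw [hxy, hx, hy] at this
    rw [inner_sub_left, real_inner_self_eq_norm_sq, hx]; linarith
  have hcs := real_inner_mul_inner_self_le ((y - x) + (d ^ 2 / 2) • x) T1
  rw [inner_add_left, inner_smul_left, xT1, h1, real_inner_self_eq_norm_sq,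
    real_inner_self_eq_norm_sq, hT1, norm_add_sq_real, hxy, inner_smul_right, he, norm_smul, hx,
    Real.norm_eq_abs, mul_one, sq_abs] at hcs
  simp at hcs
  have hd2 : 0 < d ^ 2 := by positivity
  by_contra! h
  nlinarith

/-- First and second variation of the chord-arc deficit at a minimising pair, moving the
endpoints with velocities `1` and `j`. -/
lemma chord_variation {c c1 c2 : ℝ → EuclideanSpace ℝ (Fin 3)} {L a η s1 s2 j : ℝ} (hL : 0 < L)
    (ha : 0 < a) (hc : ∀ x, HasDerivAt c (c1 x) x) (hc1 : ∀ x, HasDerivAt c1 (c2 x) x)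
    (hs : s1 < s2) (hs' : s2 < s1 + L)
    (hmin : ∀ s s', s ≤ s' → s' ≤ s + L → L * prof a ((s' - s) / L) - η ≤ ‖c s' - c s‖)
    (heq : ‖c s2 - c s1‖ = L * prof a ((s2 - s1) / L) - η) (hd : 0 < ‖c s2 - c s1‖)
    (hj : j ^ 2 = 1) :
    inner ℝ (c s2 - c s1) (j • c1 s2 - c1 s1) =
      ‖c s2 - c s1‖ * ((j - 1) * prof' a ((s2 - s1) / L)) ∧
    0 ≤ ‖j • c1 s2 - c1 s1‖ ^ 2 + inner ℝ (c s2 - c s1) (c2 s2 - c2 s1)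
      - ((j - 1) * prof' a ((s2 - s1) / L)) ^ 2
      - ‖c s2 - c s1‖ * ((j - 1) ^ 2 * prof'' a ((s2 - s1) / L) / L) := by
  have hX : ∀ e : ℝ, HasDerivAt (fun e : ℝ => s1 + e) 1 e := fun e => by
    simpa using (hasDerivAt_id e).const_add s1
  have hY : ∀ e : ℝ, HasDerivAt (fun e : ℝ => s2 + j * e) j e := fun e => by
    simpa using ((hasDerivAt_id e).const_mul j).const_add s2
  have hz : ∀ e : ℝ, HasDerivAt (fun e : ℝ => ((s2 + j * e) - (s1 + e)) / L) ((j - 1) / L) e :=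
    fun e => ((hY e).sub (hX e)).div_const L
  set ψ : ℝ → ℝ := fun e => L * prof a (((s2 + j * e) - (s1 + e)) / L) - η with hψ
  set ψ1 : ℝ → ℝ := fun e => (j - 1) * prof' a (((s2 + j * e) - (s1 + e)) / L) with hψ1
  have dψ : ∀ e, HasDerivAt ψ (ψ1 e) e := by
    intro e
    refine ((((hasDerivAt_prof ha _).comp e (hz e)).const_mul L).sub_const η).congr_deriv ?_
    simp only [hψ1]; field_simp
  have dψ1 : HasDerivAt ψ1 ((j - 1) ^ 2 * prof'' a ((s2 - s1) / L) / L) 0 := by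
    refine (((hasDerivAt_prof' a _).comp 0 (hz 0)).const_mul (j - 1)).congr_deriv ?_
    simp; field_simp
  set V : ℝ → EuclideanSpace ℝ (Fin 3) := fun e => c (s2 + j * e) - c (s1 + e) with hV
  set V1 : ℝ → EuclideanSpace ℝ (Fin 3) := fun e => j • c1 (s2 + j * e) - c1 (s1 + e) with hV1
  have dV : ∀ e, HasDerivAt V (V1 e) e := by
    intro e
    refine (((hc _).scomp e (hY e)).sub ((hc _).scomp e (hX e))).congr_deriv ?_
    simp [hV1]
  have dV1 : HasDerivAt V1 (c2 s2 - c2 s1) 0 := by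
    refine ((((hc1 _).scomp 0 (hY 0)).const_smul j).sub ((hc1 _).scomp 0 (hX 0))).congr_deriv ?_
    simp [smul_smul, ← sq, hj]
  have df : ∀ e, HasDerivAt (fun e => ‖V e‖ ^ 2 - ψ e ^ 2)
      (2 * inner ℝ (V e) (V1 e) - 2 * (ψ e * ψ1 e)) e := by
    intro e
    refine ((dV e).norm_sq.sub ((dψ e).pow 2)).congr_deriv ?_
    simp; ring
  have df1 : HasDerivAt (fun e => 2 * inner ℝ (V e) (V1 e) - 2 * (ψ e * ψ1 e))
      (2 * (inner ℝ (V 0) (c2 s2 - c2 s1) + inner ℝ (V1 0) (V1 0)) -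
        2 * (ψ1 0 * ψ1 0 + ψ 0 * ((j - 1) ^ 2 * prof'' a ((s2 - s1) / L) / L))) 0 :=
    (((dV 0).inner ℝ dV1).const_mul 2).sub (((dψ 0).mul dψ1).const_mul 2)
  have V0 : V 0 = c s2 - c s1 := by simp [hV]
  have V10 : V1 0 = j • c1 s2 - c1 s1 := by simp [hV1]
  have ψ0 : ψ 0 = ‖c s2 - c s1‖ := by simp [hψ, heq]
  have ψ10 : ψ1 0 = (j - 1) * prof' a ((s2 - s1) / L) := by simp [hψ1]
  have hlm : IsLocalMin (fun e => ‖V e‖ ^ 2 - ψ e ^ 2) 0 := by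
    have e1 : ∀ᶠ e in nhds (0:ℝ), 0 < ψ e :=
      (dψ 0).continuousAt.eventually (lt_mem_nhds (by rw [ψ0]; exact hd))
    have e2 : ∀ᶠ e in nhds (0:ℝ), s1 + e < s2 + j * e := by
      apply ContinuousAt.eventually_lt (by fun_prop) (by fun_prop); simpa using hs
    have e3 : ∀ᶠ e in nhds (0:ℝ), s2 + j * e < s1 + e + L := by
      apply ContinuousAt.eventually_lt (by fun_prop) (by fun_prop); simpa using hs'
    filter_upwards [e1, e2, e3] with e h1 h2 h3
    have h4 : ψ e ≤ ‖V e‖ := hmin _ _ h2.le h3.le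
    have : ψ e ^ 2 ≤ ‖V e‖ ^ 2 := by gcongr
    simp only [V0, ψ0]; linarith
  have r1 := hlm.hasDerivAt_eq_zero (df 0)
  have r2 := hlm.second_deriv_nonneg df df1
  rw [V0, V10, ψ0, ψ10] at r1 r2
  rw [real_inner_self_eq_norm_sq] at r2
  constructor
  · linarith
  · linarith

/-- The final estimate in the configuration symmetric about the bisecting plane. -/
lemma reflected_estimate {a z L η B d K k : ℝ} (ha : 0 < a) (hz : 0 < z) (hz' : z ≤ 1 / 2)
    (hL : 0 < L) (hη : 0 ≤ η) (hd : d = L * prof a z - η) (hB : 4 * prof'' a z / L ≤ B)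
    (hzq : 0 ≤ prof a z - z * prof' a z) (hK : 4 * π ^ 2 / L - L ≤ K)
    (hk : ∀ α, z < 1 / 2 → 0 < α → α < π / 2 → prof' a z = Real.cos α →
      4 * α ^ 2 / (z * L) - z * L ≤ k) :
    -2 * η ≤ B + d + (prof a z - z * prof' a z) * K + prof' a z * k
      - 4 * π ^ 2 / L * (prof a z - Real.sin (π * z) / π * profR a z) := by
  have h1 := mul_le_mul_of_nonneg_left hK hzq
  rcases eq_or_lt_of_le hz' with rfl | hlt
  · have hq : prof' a (1 / 2) = 0 := by
      unfold prof'; rw [show π * (1 / 2) = π / 2 by ring]; simp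
    have hq2 : prof'' a (1 / 2) = -π * profR a (1/2) := by
      unfold prof''; rw [show π * (1 / 2) = π / 2 by ring]; simp
    have hs : Real.sin (π * (1/2)) = 1 := by rw [show π * (1 / 2) = π / 2 by ring]; simp
    rw [hq] at h1 ⊢
    rw [hq2] at hB
    rw [hs, hd]
    have : 4 * π ^ 2 / L * (1 / π * profR a (1/2)) = - (4 * (-π * profR a (1/2)) / L) := by
      field_simp
    have h2 : prof a (1/2) * (4 * π ^ 2 / L) = 4 * π ^ 2 / L * prof a (1/2) := mul_comm _ _
    linarith
  · set y := π * z with hy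
    have hyz : z = y / π := by rw [hy]; field_simp
    have hy0 : 0 < y := by positivity
    have hy1 : y < π / 2 := by rw [hy]; nlinarith [pi_pos]
    have hcos : 0 < Real.cos y := Real.cos_pos_of_mem_Ioo ⟨by linarith, hy1⟩
    have hsin : 0 < Real.sin y := Real.sin_pos_of_pos_of_lt_pi hy0 (by linarith)
    have hq0 : 0 < prof' a z := mul_pos hcos (profR_pos a z)
    have hr1 : profR a z < 1 := by
      unfold profR
      rw [div_lt_one (by positivity)]
      have : 0 < (a / π * Real.sin (π * z)) ^ 2 := by rw [← hy]; positivity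
      linarith
    have hq1 : prof' a z < 1 := by
      have := Real.cos_le_one y
      unfold prof'; rw [← hy]; nlinarith [profR_pos a z]
    set α := Real.arccos (prof' a z) with hα
    have hcα : Real.cos α = prof' a z := Real.cos_arccos (by linarith) hq1.le
    have hα0 : 0 < α := Real.arccos_pos.2 hq1
    have hα1 : α < π / 2 := Real.arccos_lt_pi_div_two.2 hq0
    have h2 := mul_le_mul_of_nonneg_left (hk α hlt hα0 hα1 hcα.symm) hq0.le
    have h3 := reflected_profile_nonneg ha hy0 hy1 hα0.le (by linarith)
      (by rw [hcα]; unfold prof' profR; rw [← hy])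
    simp only at h3
    have e1 : prof'' a z = -π * Real.sin y * profR a z
      - 2 * (a ^ 2 / π) * Real.sin y * Real.cos y ^ 2 * profR a z ^ 2 := rfl
    have e2 : prof' a z = Real.cos y * profR a z := rfl
    have e3 : profR a z = 1 / (1 + (a / π * Real.sin y) ^ 2) := rfl
    rw [← e3, ← e1, ← e2, ← hyz] at h3
    have h4 := div_nonneg h3 hL.le
    have h5 : (4 * prof'' a z + 4 * π ^ 2 * (Real.sin y / π * profR a z - z * prof' a z)
        + 4 * α ^ 2 * prof' a z / z) / L = 4 * prof'' a z / L
        + 4 * π ^ 2 / L * (Real.sin y / π * profR a z) - z * prof' a z * (4 * π ^ 2 / L)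
        + prof' a z * (4 * α ^ 2 / (z * L)) := by field_simp; ring
    rw [h5] at h4
    rw [hd]
    nlinarith

/-- The final estimate in the remaining configuration. -/
lemma parallel_estimate {a z L η B d K k : ℝ} (ha : 0 < a) (hz : 0 < z) (hz' : z ≤ 1 / 2)
    (hL : 0 < L) (hη : 0 ≤ η) (hd0 : 0 < d) (hd : d = L * prof a z - η)
    (hd2 : L * prof a (1 / 2) - η ≤ 2)
    (hB : - d * prof' a z ^ 2 / (1 - d ^ 2 / 4) ≤ B) (hqd : prof' a z ^ 2 ≤ 1 - d ^ 2 / 4)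
    (hzq : 0 ≤ prof a z - z * prof' a z) (hK : 4 * π ^ 2 / L - L ≤ K) (hk : 0 ≤ k) :
    -2 * η ≤ B + d + (prof a z - z * prof' a z) * K + prof' a z * k
      - 4 * π ^ 2 / L * (prof a z - Real.sin (π * z) / π * profR a z) := by
  have h1 := mul_le_mul_of_nonneg_left hK hzq
  rcases eq_or_lt_of_le hz' with rfl | hlt
  · have hq : prof' a (1 / 2) = 0 := by
      unfold prof'; rw [show π * (1 / 2) = π / 2 by ring]; simp
    have hs : Real.sin (π * (1/2)) = 1 := by rw [show π * (1 / 2) = π / 2 by ring]; simp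
    rw [hq] at h1 hB ⊢
    rw [hs, hd]
    simp at hB
    have : 0 ≤ 4 * π ^ 2 / L * (1 / π * profR a (1/2)) := by
      have := profR_pos a (1/2)
      positivity
    have h2 : prof a (1/2) * (4 * π ^ 2 / L) = 4 * π ^ 2 / L * prof a (1/2) := mul_comm _ _
    linarith
  · set y := π * z with hy
    have hyz : z = y / π := by rw [hy]; field_simp
    have hy0 : 0 < y := by positivity
    have hy1 : y < π / 2 := by rw [hy]; nlinarith [pi_pos]
    have hcos : 0 < Real.cos y := Real.cos_pos_of_mem_Ioo ⟨by linarith, hy1⟩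
    have hq0 : 0 < prof' a z := mul_pos hcos (profR_pos a z)
    have hφ : 0 < prof a z := prof_pos ha hz (by linarith)
    set l := d / prof a z with hl
    have hlφ : l * prof a z = d := by rw [hl]; field_simp
    have hl0 : 0 < l := by positivity
    have hlL : (L - l) * prof a z = η := by rw [sub_mul, hlφ, hd]; ring
    have hlL' : l ≤ L := by
      by_contra! h
      nlinarith
    have hl2 : l * (Real.arctan (a / π) / a) ≤ 2 := by
      rw [← prof_half]
      have hle : prof a z ≤ prof a (1 / 2) := by rw [prof_half]; exact prof_le_half ha z
      nlinarith
    have h3 := parallel_profile_nonneg ha hy0 hy1 hl0.le hl2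
    simp only at h3
    have e2 : prof' a z = Real.cos y * profR a z := rfl
    have e3 : profR a z = 1 / (1 + (a / π * Real.sin y) ^ 2) := rfl
    have e4 : prof a z = Real.arctan (a / π * Real.sin y) / a := rfl
    rw [← e3, ← e2, ← e4, ← hyz, hlφ] at h3
    obtain ⟨hc0, h3⟩ := h3
    set C := 1 - d ^ 2 / 4 with hC
    set G := prof' a z ^ 2 / C with hG
    have hG0 : 0 ≤ G := by positivity
    have hG1 : G ≤ 1 := by rw [hG, div_le_one hc0]; exact hqd
    have e5 : l ^ 2 * prof a z * prof' a z ^ 2 / C = l * d * G := by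
      rw [← hlφ, hG]; field_simp
    have e6 : - d * prof' a z ^ 2 / C = - d * G := by rw [hG]; field_simp
    rw [e5] at h3
    rw [e6] at hB
    set X := Real.sin y / π * profR a z with hX
    set q := prof' a z with hq
    have g1 : -d * G + d + (prof a z - z * q) * (4 * π ^ 2 / L - L) - 4 * π ^ 2 / L * (prof a z - X)
        = (-(L * d * G) - L * η + L ^ 2 * z * q + 4 * π ^ 2 * (X - z * q)) / L := by
      rw [hd]; field_simp; ring
    have g2 : -2 * η ≤ (-(L * d * G) - L * η + L ^ 2 * z * q + 4 * π ^ 2 * (X - z * q)) / L := by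
      rw [le_div_iff₀ hL]
      have g3 : l * z * q * l ≤ L * z * q * L := by gcongr
      have g4 : (L - l) * d * G = η * l * G := by rw [← hlL, ← hlφ]; ring
      have g5 : η * l * G ≤ η * L * 1 := by gcongr
      linarith
    have := mul_nonneg hq0.le hk
    linarith

lemma div_one_add_sq_le_arctan {u : ℝ} (hu : 0 ≤ u) : u / (1 + u ^ 2) ≤ Real.arctan u := by
  have h0 : 0 ≤ Real.arctan u := Real.arctan_nonneg.2 hu
  have h1 : Real.sin (Real.arctan u) * Real.cos (Real.arctan u) = u / (1 + u ^ 2) := by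
    rw [Real.sin_arctan, Real.cos_arctan, div_mul_div_comm, mul_one, Real.mul_self_sqrt (by positivity)]
  have h2 : Real.sin (Real.arctan u) ≤ Real.arctan u := Real.sin_le h0
  have h3 := Real.cos_le_one (Real.arctan u)
  have h4 := (Real.cos_arctan_pos u).le
  rw [← h1]
  nlinarith

lemma mul_prof'_le_prof {a z : ℝ} (ha : 0 < a) (hz : 0 ≤ z) (hz' : z ≤ 1 / 2) :
    0 ≤ prof a z - z * prof' a z := by
  have hs : 0 ≤ Real.sin (π * z) :=
    Real.sin_nonneg_of_nonneg_of_le_pi (by positivity) (by nlinarith [pi_pos])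
  have h1 := div_one_add_sq_le_arctan (u := a / π * Real.sin (π * z)) (by positivity)
  have h2 := sin_sub_mul_cos_nonneg (y := π * z) (by positivity) (by nlinarith [pi_pos])
  have h3 : Real.sin (π * z) / π * profR a z ≤ prof a z := by
    unfold prof profR
    rw [le_div_iff₀ ha]
    refine le_trans (le_of_eq ?_) h1
    field_simp
  have h4 : z * prof' a z ≤ Real.sin (π * z) / π * profR a z := by
    unfold prof'
    rw [← mul_assoc]
    apply mul_le_mul_of_nonneg_right _ (profR_pos a z).le
    rw [le_div_iff₀ pi_pos]; linarith
  linarith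

section Static

variable {c c1 c2 : ℝ → EuclideanSpace ℝ (Fin 3)} {L a η s1 s2 : ℝ}

lemma norm_sq_curvature_add (hc : ∀ x, HasDerivAt c (c1 x) x)
    (hc1 : ∀ x, HasDerivAt c1 (c2 x) x) (n0 : ∀ x, ‖c x‖ = 1) (n1 : ∀ x, ‖c1 x‖ = 1) (x : ℝ) :
    inner ℝ (c x) (c1 x) = 0 ∧ inner ℝ (c x) (c2 x) = -1 ∧ ‖c2 x + c x‖ ^ 2 = ‖c2 x‖ ^ 2 - 1 := by
  have h1 : ∀ x, inner ℝ (c x) (c1 x) = 0 := by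
    intro x
    have := (hc x).norm_sq
    simp only [n0, one_pow] at this
    have := this.unique (hasDerivAt_const x (1:ℝ))
    linarith
  have h2 : inner ℝ (c x) (c2 x) = -1 := by
    have := (hc x).inner ℝ (hc1 x)
    simp only [h1] at this
    have := this.unique (hasDerivAt_const x (0:ℝ))
    rw [real_inner_self_eq_norm_sq, n1] at this
    linarith
  refine ⟨h1 x, h2, ?_⟩
  rw [norm_add_sq_real, real_inner_comm, h2, n0]; ring

lemma static_estimate_of_le_half (hL : 0 < L) (ha : 0 < a) (hη : 0 ≤ η)
    (hc : ∀ x, HasDerivAt c (c1 x) x) (hc1 : ∀ x, HasDerivAt c1 (c2 x) x) (hc2 : Continuous c2)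
    (n0 : ∀ x, ‖c x‖ = 1) (n1 : ∀ x, ‖c1 x‖ = 1)
    (per : Function.Periodic c L) (per1 : Function.Periodic c1 L) (per2 : Function.Periodic c2 L)
    (hs : s1 < s2) (hs' : (s2 - s1) / L ≤ 1 / 2)
    (hmin : ∀ s s', s ≤ s' → s' ≤ s + L → L * prof a ((s' - s) / L) - η ≤ ‖c s' - c s‖)
    (heq : ‖c s2 - c s1‖ = L * prof a ((s2 - s1) / L) - η) (hd : 0 < ‖c s2 - c s1‖) :
    -2 * η ≤ inner ℝ (c s2 - c s1) (c2 s2 - c2 s1) / ‖c s2 - c s1‖ + ‖c s2 - c s1‖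
      + (prof a ((s2 - s1) / L) - (s2 - s1) / L * prof' a ((s2 - s1) / L))
          * (∫ x in (0:ℝ)..L, ‖c2 x + c x‖ ^ 2)
      + prof' a ((s2 - s1) / L) * (∫ x in s1..s2, ‖c2 x + c x‖ ^ 2)
      - 4 * π ^ 2 / L * (prof a ((s2 - s1) / L)
          - Real.sin (π * ((s2 - s1) / L)) / π * profR a ((s2 - s1) / L)) := by
  have hc0c : Continuous c := continuous_iff_continuousAt.2 fun x => (hc x).continuousAt
  have hc1c : Continuous c1 := continuous_iff_continuousAt.2 fun x => (hc1 x).continuousAt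
  have hbasic := norm_sq_curvature_add hc hc1 n0 n1
  have hz0 : 0 < (s2 - s1) / L := div_pos (sub_pos.2 hs) hL
  have hsL : s2 < s1 + L := by
    rw [div_le_iff₀ hL] at hs'; linarith
  have hsub : ∀ p q : ℝ, ∫ x in p..q, ‖c2 x + c x‖ ^ 2 = (∫ x in p..q, ‖c2 x‖ ^ 2) - (q - p) := by
    intro p q
    simp_rw [fun x => (hbasic x).2.2]
    rw [intervalIntegral.integral_sub (by apply Continuous.intervalIntegrable; fun_prop)
      (by apply Continuous.intervalIntegrable; fun_prop)]
    simp
  obtain ⟨f1, g1⟩ := chord_variation (j := 1) hL ha hc hc1 hs hsL hmin heq hd (by norm_num)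
  obtain ⟨f2, g2⟩ := chord_variation (j := -1) hL ha hc hc1 hs hsL hmin heq hd (by norm_num)
  set z := (s2 - s1) / L with hz
  set d := ‖c s2 - c s1‖ with hdd
  set q := prof' a z with hq
  set p := inner ℝ (c1 s1) (c1 s2) with hp
  set b := inner ℝ (c s2 - c s1) (c2 s2 - c2 s1) with hb
  rw [inner_sub_right, one_smul] at f1
  rw [inner_sub_right, inner_smul_right] at f2
  have hT1 : inner ℝ (c s2 - c s1) (c1 s1) = d * q := by linarith
  have hT2 : inner ℝ (c s2 - c s1) (c1 s2) = d * q := by linarith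
  rw [one_smul, norm_sub_sq_real, n1, n1, real_inner_comm, ← hp] at g1
  rw [norm_sub_sq_real, norm_smul, inner_smul_left, n1, n1, real_inner_comm, ← hp] at g2
  norm_num at g1 g2
  have hgram := gram_relation hd.ne' (n0 s1) (n0 s2) (n1 s1) (n1 s2) rfl (hbasic s1).1
    (hbasic s2).1 hT1 hT2
  have hqd := sq_slope_le hd.ne' (n0 s1) (n0 s2) (n1 s1) rfl (hbasic s1).1 hT1
  have hK : 4 * π ^ 2 / L - L ≤ ∫ x in (0:ℝ)..L, ‖c2 x + c x‖ ^ 2 := by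
    rw [hsub]
    have := fenchel_sq hL hc hc1 hc2 n1 per per1 per2
    linarith
  have hzq := mul_prof'_le_prof ha hz0.le hs'
  have hcases : p = 2 * q ^ 2 - 1 ∨
      (0 < 1 - d ^ 2 / 4 ∧ (1 - d ^ 2 / 4) * (p - 1) + d ^ 2 / 2 * q ^ 2 = 0) := by
    rcases mul_eq_zero.1 hgram with h | h
    · left; linarith
    · rcases lt_or_ge 0 (1 - d ^ 2 / 4) with h' | h'
      · right; exact ⟨h', h⟩
      · left
        have hq0 : q ^ 2 = 0 := le_antisymm (hqd.trans h') (sq_nonneg q)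
        have hd2 : d = 2 := by nlinarith
        have hpm : -1 ≤ p := by
          have := abs_real_inner_le_norm (c1 s1) (c1 s2)
          rw [n1, n1] at this
          linarith [neg_abs_le p]
        have hxy : c s2 = -c s1 := by
          have h5 := norm_sub_sq_real (c s2) (c s1)
          have h6 := norm_add_sq_real (c s2) (c s1)
          rw [← hdd, hd2, n0, n0] at h5
          rw [n0, n0] at h6
          have h7 : ‖c s2 + c s1‖ ^ 2 = 0 := by linarith
          exact eq_neg_of_add_eq_zero_left (norm_eq_zero.1 (pow_eq_zero_iff two_ne_zero |>.1 h7))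
        have hb4 : b = -4 := by
          have e1 := (hbasic s1).2.1
          have e2 := (hbasic s2).2.1
          have e3 : inner ℝ (c s1) (c2 s2) = 1 := by
            rw [hxy, inner_neg_left] at e2; linarith
          rw [hb, inner_sub_left, inner_sub_right, inner_sub_right, e1, e2, e3, hxy, inner_neg_left, e1]
          norm_num
        rw [hb4] at g1
        linarith
  have hkarc : 0 ≤ ∫ x in s1..s2, ‖c2 x + c x‖ ^ 2 :=
    intervalIntegral.integral_nonneg hs.le fun x _ => by positivity
  rcases hcases with hR | ⟨hC, hP⟩
  · apply reflected_estimate ha hz0 hs' hL hη heq _ hzq hK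
    · intro α hz2 hα0 hα1 hqα
      have := arc_bending_bound hs hc1 hc2 n1 hα0 hα1 (by
        rw [← hp, hR, Real.cos_two_mul, ← hqα])
      rw [hsub]
      have e : z * L = s2 - s1 := by rw [hz]; field_simp
      rw [e]; linarith
    · rw [le_div_iff₀ hd]
      have e : d * (4 * prof'' a z / L) = 4 * prof'' a z / L * d := mul_comm _ _
      linarith
  · apply parallel_estimate ha hz0 hs' hL hη hd heq _ _ hqd hzq hK hkarc
    · have := hmin 0 (L / 2) (by linarith) (by linarith)
      rw [show (L / 2 - 0) / L = 1 / 2 by field_simp; ring] at this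
      have h2 := norm_sub_le (c (L / 2)) (c 0)
      rw [n0, n0] at h2
      linarith
    · rw [div_le_div_iff₀ hC hd]
      nlinarith

end Static

lemma static_estimate {c c1 c2 : ℝ → EuclideanSpace ℝ (Fin 3)} {L a η s1 s2 : ℝ}
    (hL : 0 < L) (ha : 0 < a) (hη : 0 ≤ η)
    (hc : ∀ x, HasDerivAt c (c1 x) x) (hc1 : ∀ x, HasDerivAt c1 (c2 x) x) (hc2 : Continuous c2)
    (n0 : ∀ x, ‖c x‖ = 1) (n1 : ∀ x, ‖c1 x‖ = 1)
    (per : Function.Periodic c L) (per1 : Function.Periodic c1 L) (per2 : Function.Periodic c2 L)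
    (hs : s1 < s2) (hs' : s2 < s1 + L)
    (hmin : ∀ s s', s ≤ s' → s' ≤ s + L → L * prof a ((s' - s) / L) - η ≤ ‖c s' - c s‖)
    (heq : ‖c s2 - c s1‖ = L * prof a ((s2 - s1) / L) - η) (hd : 0 < ‖c s2 - c s1‖) :
    -2 * η ≤ inner ℝ (c s2 - c s1) (c2 s2 - c2 s1) / ‖c s2 - c s1‖ + ‖c s2 - c s1‖
      + (prof a ((s2 - s1) / L) - (s2 - s1) / L * prof' a ((s2 - s1) / L))
          * (∫ x in (0:ℝ)..L, ‖c2 x + c x‖ ^ 2)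
      + prof' a ((s2 - s1) / L) * (∫ x in s1..s2, ‖c2 x + c x‖ ^ 2)
      - 4 * π ^ 2 / L * (prof a ((s2 - s1) / L)
          - Real.sin (π * ((s2 - s1) / L)) / π * profR a ((s2 - s1) / L)) := by
  rcases le_or_gt ((s2 - s1) / L) (1 / 2) with h | h
  · exact static_estimate_of_le_half hL ha hη hc hc1 hc2 n0 n1 per per1 per2 hs h hmin heq hd
  have hc0c : Continuous c := continuous_iff_continuousAt.2 fun x => (hc x).continuousAt
  have hz : (s1 + L - s2) / L = 1 - (s2 - s1) / L := by field_simp; ring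
  have hn : ‖c s1 - c s2‖ = ‖c s2 - c s1‖ := norm_sub_rev _ _
  have key := static_estimate_of_le_half (s1 := s2) (s2 := s1 + L) hL ha hη hc hc1 hc2 n0 n1 per
    per1 per2 hs' (by rw [hz]; linarith) hmin
    (by rw [hz, prof_one_sub, per s1, hn, heq]) (by rw [per s1, hn]; exact hd)
  have hin : inner ℝ (c s1 - c s2) (c2 s1 - c2 s2) = inner ℝ (c s2 - c s1) (c2 s2 - c2 s1) := by
    rw [← neg_sub (c s2), ← neg_sub (c2 s2), inner_neg_neg]
  rw [hz, prof_one_sub, prof'_one_sub, profR_one_sub, per s1, per2 s1, hn, hin,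
    mul_sub π, mul_one, Real.sin_pi_sub] at key
  have hi : ∀ p q : ℝ, IntervalIntegrable (fun x => ‖c2 x + c x‖ ^ 2) volume p q := fun p q => by
    apply Continuous.intervalIntegrable; fun_prop
  have hsplit := intervalIntegral.integral_add_adjacent_intervals (hi s1 s2) (hi s2 (s1 + L))
  have hp : Function.Periodic (fun x => ‖c2 x + c x‖ ^ 2) L := fun x => by
    simp only [per x, per2 x]
  rw [hp.intervalIntegral_add_eq s1 0, zero_add] at hsplit
  rw [← hsplit] at key ⊢
  linarith

/-- `static_estimate` for a curve with an arbitrary regular parametrisation of speed `v`. -/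
lemma static_estimate_param {g T N : ℝ → EuclideanSpace ℝ (Fin 3)} {v : ℝ → ℝ}
    {L P a η u0 w0 : ℝ} (hP : 0 < P) (ha : 0 < a) (hη : 0 ≤ η)
    (hL : L = ∫ x in (0:ℝ)..P, v x) (hv : Continuous v) (hv0 : ∀ x, 0 < v x)
    (hg : ∀ x, HasDerivAt g (v x • T x) x) (hT : ∀ x, HasDerivAt T (v x • N x) x)
    (hN : Continuous N) (n0 : ∀ x, ‖g x‖ = 1) (n1 : ∀ x, ‖T x‖ = 1)
    (perv : Function.Periodic v P) (perg : Function.Periodic g P) (perT : Function.Periodic T P)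
    (perN : Function.Periodic N P) (hs : u0 < w0) (hs' : w0 < u0 + P)
    (hmin : ∀ u w, u ≤ w → w ≤ u + P → L * prof a ((∫ x in u..w, v x) / L) - η ≤ ‖g w - g u‖)
    (heq : ‖g w0 - g u0‖ = L * prof a ((∫ x in u0..w0, v x) / L) - η)
    (hd : 0 < ‖g w0 - g u0‖) :
    let z := (∫ x in u0..w0, v x) / L;
    -2 * η ≤ inner ℝ (g w0 - g u0) (N w0 - N u0) / ‖g w0 - g u0‖ + ‖g w0 - g u0‖
      + (prof a z - z * prof' a z) * (∫ x in (0:ℝ)..P, ‖N x + g x‖ ^ 2 * v x)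
      + prof' a z * (∫ x in u0..w0, ‖N x + g x‖ ^ 2 * v x)
      - 4 * π ^ 2 / L * (prof a z - Real.sin (π * z) / π * profR a z) := by
  intro z
  have hLpos : 0 < L := by
    rw [hL]; exact intervalIntegral.intervalIntegral_pos_of_pos (hv.intervalIntegrable _ _) hv0 hP
  have hi : ∀ p q, IntervalIntegrable v volume p q := fun p q => hv.intervalIntegrable p q
  set σ : ℝ → ℝ := fun u => ∫ x in (0:ℝ)..u, v x with hσ
  have dσ : ∀ u, HasDerivAt σ (v u) u := fun u =>
    intervalIntegral.integral_hasDerivAt_right (hi _ _)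
      hv.stronglyMeasurable.stronglyMeasurableAtFilter hv.continuousAt
  have σc : Continuous σ := continuous_iff_continuousAt.2 fun x => (dσ x).continuousAt
  have σm : StrictMono σ := strictMono_of_deriv_pos fun x => by rw [(dσ x).deriv]; exact hv0 x
  have σsurj : Function.Surjective σ := σc.surjective
    (perv.tendsto_atTop_intervalIntegral_of_pos (by rw [← hL]; exact hLpos) hP)
    (perv.tendsto_atBot_intervalIntegral_of_pos (by rw [← hL]; exact hLpos) hP)
  have σdiff : ∀ u w, σ w - σ u = ∫ x in u..w, v x := fun u w =>
    intervalIntegral.integral_interval_sub_left (hi _ _) (hi _ _)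
  have σper : ∀ u, σ (u + P) = σ u + L := by
    intro u
    have := σdiff u (u + P)
    rw [perv.intervalIntegral_add_eq u 0, zero_add, ← hL] at this
    linarith
  set e : ℝ ≃o ℝ := σm.orderIsoOfSurjective σ σsurj with he
  set h : ℝ → ℝ := fun s => e.symm s with hh
  have hσh : ∀ s, σ (h s) = s := fun s => e.apply_symm_apply s
  have hhσ : ∀ u, h (σ u) = u := fun u => e.symm_apply_apply u
  have hhc : Continuous h := e.symm.continuous
  have hhm : StrictMono h := e.symm.strictMono
  have dh : ∀ s, HasDerivAt h (v (h s))⁻¹ s := fun s =>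
    HasDerivAt.of_local_left_inverse hhc.continuousAt (dσ (h s)) (hv0 _).ne'
      (Filter.Eventually.of_forall hσh)
  have hper : ∀ s, h (s + L) = h s + P := by
    intro s
    apply σm.injective
    rw [hσh, σper, hσh]
  have Tc : Continuous T := continuous_iff_continuousAt.2 fun x => (hT x).continuousAt
  have gc : Continuous g := continuous_iff_continuousAt.2 fun x => (hg x).continuousAt
  have cov : ∀ p q, ∫ x in p..q, ‖N x + g x‖ ^ 2 * v x =
      ∫ s in σ p..σ q, ‖N (h s) + g (h s)‖ ^ 2 := by
    intro p q
    rw [← intervalIntegral.integral_comp_mul_deriv (f := σ) (f' := v)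
      (g := fun s => ‖N (h s) + g (h s)‖ ^ 2) (fun x _ => dσ x) hv.continuousOn
      (by fun_prop)]
    simp only [Function.comp, hhσ]
  have σ0 : σ 0 = 0 := by simp [hσ]
  have σP : σ P = L := by have := σper 0; rw [σ0] at this; simpa using this
  have key := static_estimate (c := fun s => g (h s)) (c1 := fun s => T (h s))
    (c2 := fun s => N (h s)) (s1 := σ u0) (s2 := σ w0) hLpos ha hη
    (fun s => by
      have := (hg (h s)).scomp s (dh s)
      rwa [smul_smul, inv_mul_cancel₀ (hv0 _).ne', one_smul] at this)
    (fun s => by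
      have := (hT (h s)).scomp s (dh s)
      rwa [smul_smul, inv_mul_cancel₀ (hv0 _).ne', one_smul] at this)
    (hN.comp hhc) (fun s => n0 _) (fun s => n1 _)
    (fun s => by simp only [hper, perg (h s)]) (fun s => by simp only [hper, perT (h s)])
    (fun s => by simp only [hper, perN (h s)]) (σm hs) (by rw [← σper]; exact σm hs')
    (fun s s' h1 h2 => by
      have := hmin (h s) (h s') (hhm.monotone h1) (by rw [← hper]; exact hhm.monotone h2)
      rwa [← σdiff, hσh, hσh] at this)
    (by simp only [hhσ, σdiff]; exact heq) (by simp only [hhσ]; exact hd)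
  simp only [hhσ, σdiff] at key
  rw [cov, cov, σ0, σP]
  exact key

namespace SphereCSF

variable (F : SphereCSF D) {t : ℝ}

lemma contDiff_slice (ht : t ∈ D) : ContDiff ℝ (⊤ : ℕ∞) (fun u => F.γ u t) := by
  rw [← contDiffOn_univ]
  exact F.smooth.comp (t := Set.univ ×ˢ D) (f := fun u : ℝ => (u, t))
    (by fun_prop) (fun u _ => ⟨Set.mem_univ _, ht⟩)

lemma contDiff_deriv_slice (ht : t ∈ D) :
    ContDiff ℝ (⊤ : ℕ∞) (deriv fun u => F.γ u t) :=
  (contDiff_infty_iff_deriv.1 (F.contDiff_slice ht)).2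

lemma speed_pos (ht : t ∈ D) (u : ℝ) : 0 < F.speed u t := norm_pos_iff.2 (F.regular t ht u)

lemma contDiff_speed (ht : t ∈ D) : ContDiff ℝ (⊤ : ℕ∞) (fun u => F.speed u t) :=
  (F.contDiff_deriv_slice ht).norm ℝ (F.regular t ht)

/-- The unit tangent vector. -/
def tangent (u t : ℝ) : EuclideanSpace ℝ (Fin 3) := pS F.γ F.γ u t

/-- The second arclength derivative. -/
def accel (u t : ℝ) : EuclideanSpace ℝ (Fin 3) := pS F.γ (pS F.γ F.γ) u t

lemma tangent_eq (u t : ℝ) :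
    F.tangent u t = (F.speed u t)⁻¹ • deriv (fun v => F.γ v t) u := rfl

lemma accel_eq (u t : ℝ) :
    F.accel u t = (F.speed u t)⁻¹ • deriv (fun v => F.tangent v t) u := rfl

lemma curvVec_eq (u t : ℝ) : curvVec F.γ u t = F.accel u t + F.γ u t := rfl

lemma contDiff_tangent (ht : t ∈ D) : ContDiff ℝ (⊤ : ℕ∞) (fun u => F.tangent u t) :=
  ((F.contDiff_speed ht).inv fun u => (F.speed_pos ht u).ne').smul (F.contDiff_deriv_slice ht)

lemma contDiff_accel (ht : t ∈ D) : ContDiff ℝ (⊤ : ℕ∞) (fun u => F.accel u t) :=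
  ((F.contDiff_speed ht).inv fun u => (F.speed_pos ht u).ne').smul
    (contDiff_infty_iff_deriv.1 (F.contDiff_tangent ht)).2

lemma hasDerivAt_slice (ht : t ∈ D) (u : ℝ) :
    HasDerivAt (fun u => F.γ u t) (F.speed u t • F.tangent u t) u := by
  rw [tangent_eq, smul_smul, mul_inv_cancel₀ (F.speed_pos ht u).ne', one_smul]
  exact ((F.contDiff_slice ht).differentiable (by simp) u).hasDerivAt

lemma hasDerivAt_tangent (ht : t ∈ D) (u : ℝ) :
    HasDerivAt (fun u => F.tangent u t) (F.speed u t • F.accel u t) u := by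
  rw [accel_eq, smul_smul, mul_inv_cancel₀ (F.speed_pos ht u).ne', one_smul]
  exact ((F.contDiff_tangent ht).differentiable (by simp) u).hasDerivAt

lemma norm_tangent (ht : t ∈ D) (u : ℝ) : ‖F.tangent u t‖ = 1 := by
  rw [tangent_eq, norm_smul, norm_inv, Real.norm_of_nonneg (F.speed_pos ht u).le]
  exact inv_mul_cancel₀ (F.speed_pos ht u).ne'

lemma _root_.Function.Periodic.deriv_periodic {E : Type*} [NormedAddCommGroup E] [NormedSpace ℝ E]
    {f : ℝ → E} {P : ℝ} (hf : Function.Periodic f P) : Function.Periodic (deriv f) P := by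
  intro x
  have h : (fun x => f (x + P)) = f := funext hf
  have := deriv_comp_add_const f P x
  rw [← this, h]

lemma periodic_speed (ht : t ∈ D) : Function.Periodic (fun u => F.speed u t) (2 * π) := by
  intro u
  simp only [speed]
  rw [(F.periodic t ht).deriv_periodic u]

lemma periodic_tangent (ht : t ∈ D) : Function.Periodic (fun u => F.tangent u t) (2 * π) := by
  intro u
  simp only [tangent_eq]
  rw [(F.periodic t ht).deriv_periodic u, show F.speed (u + 2 * π) t = F.speed u t from F.periodic_speed ht u]

lemma periodic_accel (ht : t ∈ D) : Function.Periodic (fun u => F.accel u t) (2 * π) := by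
  intro u
  simp only [accel_eq]
  rw [(F.periodic_tangent ht).deriv_periodic u, show F.speed (u + 2 * π) t = F.speed u t from F.periodic_speed ht u]

lemma inner_slice_tangent (ht : t ∈ D) (u : ℝ) : inner ℝ (F.γ u t) (F.tangent u t) = 0 := by
  have h := (F.hasDerivAt_slice ht u).norm_sq
  simp only [F.spherical t ht, one_pow] at h
  have := h.unique (hasDerivAt_const u (1:ℝ))
  rw [inner_smul_right] at this
  have hv := (F.speed_pos ht u).ne'
  simpa [hv] using this

lemma inner_slice_accel (ht : t ∈ D) (u : ℝ) : inner ℝ (F.γ u t) (F.accel u t) = -1 := by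
  have h := (F.hasDerivAt_slice ht u).inner ℝ (F.hasDerivAt_tangent ht u)
  simp only [F.inner_slice_tangent ht] at h
  have h2 := h.unique (hasDerivAt_const u (0:ℝ))
  rw [inner_smul_right, inner_smul_left, real_inner_self_eq_norm_sq, F.norm_tangent ht] at h2
  have hv := (F.speed_pos ht u)
  simp at h2
  nlinarith

lemma inner_tangent_accel (ht : t ∈ D) (u : ℝ) : inner ℝ (F.tangent u t) (F.accel u t) = 0 := by
  have h := (F.hasDerivAt_tangent ht u).norm_sq
  simp only [F.norm_tangent ht, one_pow] at h
  have := h.unique (hasDerivAt_const u (1:ℝ))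
  rw [inner_smul_right] at this
  have hv := (F.speed_pos ht u).ne'
  simpa [hv] using this

lemma inner_tangent_curvVec (ht : t ∈ D) (u : ℝ) :
    inner ℝ (F.tangent u t) (curvVec F.γ u t) = 0 := by
  rw [curvVec_eq, inner_add_right, F.inner_tangent_accel ht, real_inner_comm,
    F.inner_slice_tangent ht, add_zero]

lemma inner_accel_curvVec (ht : t ∈ D) (u : ℝ) :
    inner ℝ (F.accel u t) (curvVec F.γ u t) = F.curvSq u t := by
  have h : inner ℝ (F.γ u t) (curvVec F.γ u t) = 0 := by
    rw [curvVec_eq, inner_add_right, F.inner_slice_accel ht, real_inner_self_eq_norm_sq,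
      F.spherical t ht]; norm_num
  rw [curvSq, ← real_inner_self_eq_norm_sq]
  nth_rewrite 2 [curvVec_eq]
  rw [inner_add_left, h, add_zero]

lemma length_pos (ht : t ∈ D) : 0 < F.length t :=
  intervalIntegral.intervalIntegral_pos_of_pos
    ((F.contDiff_speed ht).continuous.intervalIntegrable _ _) (F.speed_pos ht) (by positivity)

lemma contDiff_curvVec (ht : t ∈ D) : ContDiff ℝ (⊤ : ℕ∞) (fun u => curvVec F.γ u t) :=
  (F.contDiff_accel ht).add (F.contDiff_slice ht)

/-- The static part of the maximum principle: the time derivative of the chord-arc deficit at a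
spatial minimum. -/
lemma static_estimate_slice (ht : t ∈ D) {a η u0 w0 : ℝ} (ha : 0 < a) (hη : 0 ≤ η)
    (hs : u0 < w0) (hs' : w0 < u0 + 2 * π)
    (hmin : ∀ u w, u ≤ w → w ≤ u + 2 * π →
      F.length t * prof a ((∫ x in u..w, F.speed x t) / F.length t) - η ≤ ‖F.γ w t - F.γ u t‖)
    (heq : ‖F.γ w0 t - F.γ u0 t‖ =
      F.length t * prof a ((∫ x in u0..w0, F.speed x t) / F.length t) - η)
    (hd : 0 < ‖F.γ w0 t - F.γ u0 t‖) :
    let z := (∫ x in u0..w0, F.speed x t) / F.length t;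
    -2 * η ≤ inner ℝ (F.γ w0 t - F.γ u0 t) (curvVec F.γ w0 t - curvVec F.γ u0 t)
        / ‖F.γ w0 t - F.γ u0 t‖
      + (prof a z - z * prof' a z) * (∫ x in (0:ℝ)..(2 * π), F.curvSq x t * F.speed x t)
      + prof' a z * (∫ x in u0..w0, F.curvSq x t * F.speed x t)
      - 4 * π ^ 2 / F.length t * (prof a z - Real.sin (π * z) / π * profR a z) := by
  intro z
  have key := static_estimate_param (g := fun u => F.γ u t) (T := fun u => F.tangent u t)
    (N := fun u => F.accel u t) (v := fun u => F.speed u t) (L := F.length t) (P := 2 * π)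
    (by positivity) ha hη rfl (F.contDiff_speed ht).continuous (F.speed_pos ht)
    (F.hasDerivAt_slice ht) (F.hasDerivAt_tangent ht) (F.contDiff_accel ht).continuous
    (F.spherical t ht) (F.norm_tangent ht) (F.periodic_speed ht) (F.periodic t ht)
    (F.periodic_tangent ht) (F.periodic_accel ht) hs hs' hmin heq hd
  have e : inner ℝ (F.γ w0 t - F.γ u0 t) (curvVec F.γ w0 t - curvVec F.γ u0 t)
        / ‖F.γ w0 t - F.γ u0 t‖ =
      inner ℝ (F.γ w0 t - F.γ u0 t) (F.accel w0 t - F.accel u0 t) / ‖F.γ w0 t - F.γ u0 t‖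
        + ‖F.γ w0 t - F.γ u0 t‖ := by
    rw [curvVec_eq, curvVec_eq, add_sub_add_comm, inner_add_right, real_inner_self_eq_norm_sq]
    field_simp
  rw [e]
  exact key

end SphereCSF

namespace SphereCSF

variable {T : ℝ} (F : SphereCSF (Set.Ico 0 T)) {t : ℝ}

lemma contDiffAt_interior (ht : t ∈ Set.Ioo 0 T) (u : ℝ) :
    ContDiffAt ℝ (⊤ : ℕ∞) (fun p : ℝ × ℝ => F.γ p.1 p.2) (u, t) := by
  refine F.smooth.contDiffAt ?_
  exact prod_mem_nhds Filter.univ_mem (Ico_mem_nhds ht.1 ht.2)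

lemma hasFDerivAt_interior (ht : t ∈ Set.Ioo 0 T) (u : ℝ) :
    HasFDerivAt (fun p : ℝ × ℝ => F.γ p.1 p.2)
      (fderiv ℝ (fun p : ℝ × ℝ => F.γ p.1 p.2) (u, t)) (u, t) :=
  ((F.contDiffAt_interior ht u).differentiableAt (by simp)).hasFDerivAt

lemma deriv_slice_eq_fderiv (ht : t ∈ Set.Ioo 0 T) (u : ℝ) :
    deriv (fun v => F.γ v t) u =
      fderiv ℝ (fun p : ℝ × ℝ => F.γ p.1 p.2) (u, t) (1, 0) := by
  have h : HasDerivAt (fun v : ℝ => (v, t)) ((1:ℝ), (0:ℝ)) u :=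
    (hasDerivAt_id u).prodMk (hasDerivAt_const u t)
  exact ((F.hasFDerivAt_interior ht u).comp_hasDerivAt u h).deriv

lemma hasDerivAt_flow (ht : t ∈ Set.Ioo 0 T) (u : ℝ) :
    HasDerivAt (fun s => F.γ u s) (curvVec F.γ u t) t :=
  (F.flow t (Set.Ioo_subset_Ico_self ht) u).hasDerivAt (Ico_mem_nhds ht.1 ht.2)

lemma curvVec_eq_fderiv (ht : t ∈ Set.Ioo 0 T) (u : ℝ) :
    curvVec F.γ u t = fderiv ℝ (fun p : ℝ × ℝ => F.γ p.1 p.2) (u, t) (0, 1) := by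
  have h : HasDerivAt (fun s : ℝ => (u, s)) ((0:ℝ), (1:ℝ)) t :=
    (hasDerivAt_const t u).prodMk (hasDerivAt_id t)
  exact (F.hasDerivAt_flow ht u).unique ((F.hasFDerivAt_interior ht u).comp_hasDerivAt t h)

lemma hasDerivAt_deriv_slice (ht : t ∈ Set.Ioo 0 T) (u : ℝ) :
    HasDerivAt (fun s => deriv (fun v => F.γ v s) u) (deriv (fun v => curvVec F.γ v t) u) t := by
  set G : ℝ × ℝ → EuclideanSpace ℝ (Fin 3) := fun p => F.γ p.1 p.2 with hG
  have hc := F.contDiffAt_interior ht u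
  have hD : HasFDerivAt (fderiv ℝ G) (fderiv ℝ (fderiv ℝ G) (u, t)) (u, t) :=
    ((hc.fderiv_right (m := 1) (by norm_cast)).differentiableAt (by simp)).hasFDerivAt
  have h1 : HasDerivAt (fun v : ℝ => (v, t)) ((1:ℝ), (0:ℝ)) u :=
    (hasDerivAt_id u).prodMk (hasDerivAt_const u t)
  have h2 : HasDerivAt (fun s : ℝ => (u, s)) ((0:ℝ), (1:ℝ)) t :=
    (hasDerivAt_const t u).prodMk (hasDerivAt_id t)
  have e1 : HasDerivAt (fun s => fderiv ℝ G (u, s) (1, 0))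
      (fderiv ℝ (fderiv ℝ G) (u, t) (0, 1) (1, 0)) t := by
    have := (ContinuousLinearMap.apply ℝ (EuclideanSpace ℝ (Fin 3))
      ((1:ℝ), (0:ℝ))).hasFDerivAt.comp_hasDerivAt t (hD.comp_hasDerivAt t h2)
    exact this
  have e2 : HasDerivAt (fun v => fderiv ℝ G (v, t) (0, 1))
      (fderiv ℝ (fderiv ℝ G) (u, t) (1, 0) (0, 1)) u := by
    have := (ContinuousLinearMap.apply ℝ (EuclideanSpace ℝ (Fin 3))
      ((0:ℝ), (1:ℝ))).hasFDerivAt.comp_hasDerivAt u (hD.comp_hasDerivAt u h1)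
    exact this
  have e3 : (fun v => curvVec F.γ v t) = fun v => fderiv ℝ G (v, t) (0, 1) :=
    funext fun v => F.curvVec_eq_fderiv ht v
  have h4 : (2 : WithTop ℕ∞) ≤ ((⊤ : ℕ∞) : WithTop ℕ∞) := 
    WithTop.coe_le_coe.2 (le_top : (2 : ℕ∞) ≤ ⊤)
  rw [e3, e2.deriv, (hc.isSymmSndFDerivAt (by simpa using h4)).eq]
  refine e1.congr_of_eventuallyEq ?_
  filter_upwards [Ioo_mem_nhds ht.1 ht.2] with s hs using F.deriv_slice_eq_fderiv hs u

/-- Evolution of the parametrisation speed. -/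
lemma hasDerivAt_speed (ht : t ∈ Set.Ioo 0 T) (u : ℝ) :
    HasDerivAt (fun s => F.speed u s) (-(F.curvSq u t * F.speed u t)) t := by
  have ht' := Set.Ioo_subset_Ico_self ht
  have h1 := (F.hasDerivAt_deriv_slice ht u).norm_sq.sqrt
    (by have := F.regular t ht' u; positivity)
  simp only [Real.sqrt_sq (norm_nonneg _)] at h1
  refine h1.congr_deriv ?_
  have hK : HasDerivAt (fun v => curvVec F.γ v t) (deriv (fun v => curvVec F.γ v t) u) u :=
    ((F.contDiff_curvVec ht').differentiable (by simp) u).hasDerivAt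
  have h2 := (F.hasDerivAt_tangent ht' u).inner ℝ hK
  simp only [F.inner_tangent_curvVec ht'] at h2
  have h3 := h2.unique (hasDerivAt_const u (0:ℝ))
  rw [inner_smul_left, F.inner_accel_curvVec ht', tangent_eq, inner_smul_left] at h3
  have hv := F.speed_pos ht' u
  have hv2 : ‖deriv (fun v => F.γ v t) u‖ = F.speed u t := rfl
  rw [hv2]
  simp at h3
  field_simp at h3 ⊢
  linarith

lemma continuousOn_deriv_slice :
    ContinuousOn (fun p : ℝ × ℝ => deriv (fun v => F.γ v p.2) p.1)
      (Set.univ ×ˢ Set.Ico 0 T) := by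
  have hU : UniqueDiffOn ℝ ((Set.univ : Set ℝ) ×ˢ Set.Ico (0:ℝ) T) :=
    uniqueDiffOn_univ.prod (uniqueDiffOn_Ico 0 T)
  have hc := (F.smooth.continuousOn_fderivWithin hU (by simp)).clm_apply
    (continuousOn_const (c := ((1:ℝ), (0:ℝ))))
  refine hc.congr ?_
  rintro ⟨u, t⟩ ⟨_, ht⟩
  have hf := ((F.smooth.differentiableOn (by simp)) (u, t) ⟨Set.mem_univ _, ht⟩).hasFDerivWithinAt
  have h : HasDerivAt (fun v : ℝ => (v, t)) ((1:ℝ), (0:ℝ)) u :=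
    (hasDerivAt_id u).prodMk (hasDerivAt_const u t)
  have := hf.comp_hasDerivWithinAt (s := Set.univ) u h.hasDerivWithinAt
    (t := Set.univ ×ˢ Set.Ico 0 T) (fun v _ => ⟨Set.mem_univ _, ht⟩)
  exact (hasDerivWithinAt_univ.1 this).deriv

lemma continuousOn_speed :
    ContinuousOn (fun p : ℝ × ℝ => F.speed p.1 p.2) (Set.univ ×ˢ Set.Ico 0 T) :=
  F.continuousOn_deriv_slice.norm

lemma continuousOn_curvSq :
    ContinuousOn (fun p : ℝ × ℝ => F.curvSq p.1 p.2) (Set.univ ×ˢ Set.Ioo 0 T) := by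
  have hO : IsOpen ((Set.univ : Set ℝ) ×ˢ Set.Ioo (0:ℝ) T) := isOpen_univ.prod isOpen_Ioo
  have hc := ((F.smooth.mono (Set.prod_mono_right Set.Ioo_subset_Ico_self)).continuousOn_fderiv_of_isOpen
    hO (by simp)).clm_apply (continuousOn_const (c := ((0:ℝ), (1:ℝ))))
  refine (hc.norm.pow 2).congr ?_
  rintro ⟨u, t⟩ ⟨_, ht⟩
  simp only [curvSq, F.curvVec_eq_fderiv ht, Pi.pow_apply]

lemma hasDerivAt_integral_speed (ht : t ∈ Set.Ioo 0 T) (u w : ℝ) :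
    HasDerivAt (fun s => ∫ x in u..w, F.speed x s)
      (-∫ x in u..w, F.curvSq x t * F.speed x t) t := by
  obtain ⟨ε, hε, hball⟩ := Metric.isOpen_iff.1 isOpen_Ioo t ht
  have hsub : Metric.closedBall t (ε / 2) ⊆ Set.Ioo 0 T :=
    (Metric.closedBall_subset_ball (by linarith)).trans hball
  have hcont : ContinuousOn (fun p : ℝ × ℝ => F.curvSq p.1 p.2 * F.speed p.1 p.2)
      (Set.univ ×ˢ Set.Ioo 0 T) :=
    F.continuousOn_curvSq.mul (F.continuousOn_speed.mono
      (Set.prod_mono_right Set.Ioo_subset_Ico_self))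
  obtain ⟨C, hC⟩ := (isCompact_uIcc.prod (isCompact_closedBall t (ε / 2))).exists_bound_of_continuousOn
    (s := Set.uIcc u w ×ˢ Metric.closedBall t (ε / 2))
    (hcont.mono (Set.prod_mono (Set.subset_univ _) hsub))
  have hslice : ∀ s ∈ Set.Ioo 0 T, Continuous fun x => F.speed x s := fun s hs =>
    (F.contDiff_speed (Set.Ioo_subset_Ico_self hs)).continuous
  have hslice' : Continuous fun x => F.curvSq x t := by
    have := (F.contDiff_curvVec (Set.Ioo_subset_Ico_self ht)).continuous
    unfold curvSq; fun_prop
  have key := intervalIntegral.hasDerivAt_integral_of_dominated_loc_of_deriv_le (μ := volume)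
    (F := fun s x => F.speed x s) (F' := fun s x => -(F.curvSq x s * F.speed x s))
    (a := u) (b := w) (bound := fun _ => C)
    (Metric.closedBall_mem_nhds t (half_pos hε))
    (by filter_upwards [Ioo_mem_nhds ht.1 ht.2] with s hs
        exact (hslice s hs).aestronglyMeasurable)
    ((hslice t ht).intervalIntegrable _ _)
    ((hslice'.mul (hslice t ht)).neg.aestronglyMeasurable)
    (Filter.Eventually.of_forall fun x hx s hs => by
      rw [norm_neg]; exact hC (x, s) ⟨Set.uIoc_subset_uIcc hx, hs⟩)
    (by simp)
    (Filter.Eventually.of_forall fun x _ s hs => F.hasDerivAt_speed (hsub hs) x)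
  rw [← intervalIntegral.integral_neg]
  exact key.2

end SphereCSF

/-- Derivative of a rescaled profile `L · prof A (S / L)` along a one-parameter family. -/
lemma hasDerivAt_mul_prof {A S L : ℝ → ℝ} {A' S' L' t : ℝ} (hA : HasDerivAt A A' t)
    (hS : HasDerivAt S S' t) (hL : HasDerivAt L L' t) (hA0 : 0 < A t) (hL0 : 0 < L t) :
    HasDerivAt (fun s => L s * prof (A s) (S s / L s))
      (L' * (prof (A t) (S t / L t) - S t / L t * prof' (A t) (S t / L t))
        + S' * prof' (A t) (S t / L t)
        + L t * (A' / A t) * (Real.sin (π * (S t / L t)) / π * profR (A t) (S t / L t)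
          - prof (A t) (S t / L t))) t := by
  have hz := (hS.div hL hL0.ne').const_mul π
  have h := hL.mul ((((hA.div_const π).mul hz.sin).arctan).div hA hA0.ne')
  refine h.congr_deriv ?_
  simp only [prof', prof, profR, Pi.mul_apply, Pi.div_apply]
  have h2 : (1 + (A t / π * Real.sin (π * (S t / L t))) ^ 2) ≠ 0 := by positivity
  generalize hsin : Real.sin (π * (S t / L t)) = σ at *
  generalize Real.cos (π * (S t / L t)) = c at *
  generalize Real.arctan (A t / π * σ) = θ at *
  generalize hq : 1 + (A t / π * σ) ^ 2 = q at *
  have := pi_ne_zero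
  field_simp
  ring

namespace SphereCSF

section Continuity

variable {T : ℝ} (F : SphereCSF (Set.Ico 0 T)) {t b : ℝ}

lemma continuousOn_integral_speed (hb : b ∈ Set.Ico 0 T) :
    ContinuousOn (fun p : ℝ × ℝ × ℝ => ∫ x in p.2.1..p.2.2, F.speed x p.1)
      (Set.Icc 0 b ×ˢ Set.univ) := by
  have hκ : ∀ s, max 0 (min s b) ∈ Set.Ico 0 T := fun s =>
    ⟨le_max_left _ _, (max_le hb.1 (min_le_right _ _)).trans_lt hb.2⟩
  have hf : Continuous (Function.uncurry fun (p : ℝ × ℝ × ℝ) (x : ℝ) =>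
      F.speed x (max 0 (min p.1 b))) :=
    F.continuousOn_speed.comp_continuous
      (f := fun q : (ℝ × ℝ × ℝ) × ℝ => (q.2, max 0 (min q.1.1 b))) (by fun_prop)
      fun q => ⟨Set.mem_univ _, hκ _⟩
  have h1 := intervalIntegral.continuous_parametric_intervalIntegral_of_continuous (μ := volume)
    (a₀ := 0) hf (s := fun p : ℝ × ℝ × ℝ => p.2.2) (by fun_prop)
  have h2 := intervalIntegral.continuous_parametric_intervalIntegral_of_continuous (μ := volume)
    (a₀ := 0) hf (s := fun p : ℝ × ℝ × ℝ => p.2.1) (by fun_prop)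
  refine (h1.sub h2).continuousOn.congr ?_
  rintro ⟨s, u, w⟩ ⟨hs, _⟩
  have hs' : max 0 (min s b) = s := by rw [min_eq_left hs.2, max_eq_right hs.1]
  have hc := (F.contDiff_speed (hs' ▸ hκ s)).continuous
  simp only [Pi.sub_apply, hs']
  rw [intervalIntegral.integral_interval_sub_left (hc.intervalIntegrable _ _)
    (hc.intervalIntegrable _ _)]

lemma continuousOn_length (hb : b ∈ Set.Ico 0 T) : ContinuousOn F.length (Set.Icc 0 b) :=
  (F.continuousOn_integral_speed hb).comp (f := fun s : ℝ => (s, ((0:ℝ), 2 * π)))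
    (by fun_prop) fun _ hs => ⟨hs, Set.mem_univ _⟩

lemma continuousOn_inv_length_sq (hb : b ∈ Set.Ico 0 T) :
    ContinuousOn (fun s => ((F.length s) ^ 2)⁻¹) (Set.Icc 0 b) :=
  ((F.continuousOn_length hb).pow 2).inv₀ fun _ hs =>
    pow_ne_zero 2 (F.length_pos ⟨hs.1, hs.2.trans_lt hb.2⟩).ne'

lemma continuousOn_tau (hb : b ∈ Set.Ico 0 T) : ContinuousOn F.tau (Set.Icc 0 b) := by
  have h := (F.continuousOn_inv_length_sq hb).integrableOn_Icc (μ := volume)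
  have := intervalIntegral.continuousOn_primitive_interval (a := 0) (b := b)
    (by rwa [Set.uIcc_of_le hb.1])
  rwa [Set.uIcc_of_le hb.1] at this

lemma hasDerivAt_length (ht : t ∈ Set.Ioo 0 T) :
    HasDerivAt F.length (-∫ x in (0:ℝ)..(2 * π), F.curvSq x t * F.speed x t) t :=
  F.hasDerivAt_integral_speed ht 0 (2 * π)

lemma hasDerivAt_tau (ht : t ∈ Set.Ioo 0 T) : HasDerivAt F.tau ((F.length t) ^ 2)⁻¹ t := by
  have hc : ContinuousOn (fun s => ((F.length s) ^ 2)⁻¹) (Set.Ioo 0 T) := fun s hs =>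
    (((F.hasDerivAt_length hs).continuousAt.pow 2).inv₀
      (pow_ne_zero 2 (F.length_pos (Set.Ioo_subset_Ico_self hs)).ne')).continuousWithinAt
  refine intervalIntegral.integral_hasDerivAt_right ?_
    (hc.stronglyMeasurableAtFilter isOpen_Ioo _ ht) (hc.continuousAt (Ioo_mem_nhds ht.1 ht.2))
  exact ContinuousOn.intervalIntegrable_of_Icc ht.1.le
    (F.continuousOn_inv_length_sq (Set.Ioo_subset_Ico_self ht))

/-- The decaying profile parameter `a e^{-4π²τ(t)}`. -/
def amp (a t : ℝ) : ℝ := a * Real.exp (-4 * π ^ 2 * F.tau t)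

/-- Chord length minus the profile bound, for the arc from `u` to `w`. -/
def gap (a t u w : ℝ) : ℝ :=
  ‖F.γ w t - F.γ u t‖ - F.length t * prof (F.amp a t) ((∫ x in u..w, F.speed x t) / F.length t)

lemma amp_pos {a : ℝ} (ha : 0 < a) : 0 < F.amp a t := by unfold amp; positivity

lemma hasDerivAt_amp (a : ℝ) (ht : t ∈ Set.Ioo 0 T) :
    HasDerivAt (F.amp a) (-4 * π ^ 2 * ((F.length t) ^ 2)⁻¹ * F.amp a t) t :=
  ((((F.hasDerivAt_tau ht).const_mul (-4 * π ^ 2)).exp).const_mul a).congr_deriv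
    (by unfold amp; ring)

lemma continuousOn_amp (a : ℝ) (hb : b ∈ Set.Ico 0 T) : ContinuousOn (F.amp a) (Set.Icc 0 b) := by
  have := F.continuousOn_tau hb
  unfold amp
  fun_prop

lemma continuousOn_gap {a : ℝ} (ha : 0 < a) (hb : b ∈ Set.Ico 0 T) :
    ContinuousOn (fun p : ℝ × ℝ × ℝ => F.gap a p.1 p.2.1 p.2.2) (Set.Icc 0 b ×ˢ Set.univ) := by
  have hγ : ∀ f : ℝ × ℝ × ℝ → ℝ, Continuous f →
      ContinuousOn (fun p : ℝ × ℝ × ℝ => F.γ (f p) p.1) (Set.Icc 0 b ×ˢ Set.univ) := fun f hf =>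
    F.smooth.continuousOn.comp (f := fun p : ℝ × ℝ × ℝ => (f p, p.1)) (by fun_prop)
      fun p hp => ⟨Set.mem_univ _, hp.1.1, hp.1.2.trans_lt hb.2⟩
  have h1 := hγ (fun p => p.2.1) (by fun_prop)
  have h2 := hγ (fun p => p.2.2) (by fun_prop)
  have hmap : Set.MapsTo (fun p : ℝ × ℝ × ℝ => p.1) (Set.Icc 0 b ×ˢ Set.univ) (Set.Icc 0 b) :=
    fun p hp => hp.1
  have hA := (F.continuousOn_amp a hb).comp continuous_fst.continuousOn hmap
  have hL := (F.continuousOn_length hb).comp continuous_fst.continuousOn hmap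
  have hS := F.continuousOn_integral_speed hb
  have hz := hS.div hL fun p hp => (F.length_pos ⟨hp.1.1, hp.1.2.trans_lt hb.2⟩).ne'
  unfold gap prof
  exact (h2.sub h1).norm.sub (hL.mul ((Real.continuous_arctan.comp_continuousOn
    ((hA.div_const π).mul (Real.continuous_sin.comp_continuousOn (hz.const_mul π)))).div hA
      fun p _ => (F.amp_pos ha).ne'))

lemma hasDerivAt_gap {a u w : ℝ} (ha : 0 < a) (ht : t ∈ Set.Ioo 0 T)
    (hd : 0 < ‖F.γ w t - F.γ u t‖) :
    let z := (∫ x in u..w, F.speed x t) / F.length t;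
    HasDerivAt (fun s => F.gap a s u w)
      (inner ℝ (F.γ w t - F.γ u t) (curvVec F.γ w t - curvVec F.γ u t) / ‖F.γ w t - F.γ u t‖
        + (prof (F.amp a t) z - z * prof' (F.amp a t) z)
          * (∫ x in (0:ℝ)..(2 * π), F.curvSq x t * F.speed x t)
        + prof' (F.amp a t) z * (∫ x in u..w, F.curvSq x t * F.speed x t)
        - 4 * π ^ 2 / F.length t
          * (prof (F.amp a t) z - Real.sin (π * z) / π * profR (F.amp a t) z)) t := by
  intro z
  have hL := F.length_pos (Set.Ioo_subset_Ico_self ht)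
  have hA := F.amp_pos (t := t) ha
  have h1 := ((F.hasDerivAt_flow ht w).sub (F.hasDerivAt_flow ht u)).norm_sq.sqrt
    (by simp only [Pi.sub_apply]; positivity)
  have h2 := hasDerivAt_mul_prof (F.hasDerivAt_amp a ht) (F.hasDerivAt_integral_speed ht u w)
    (F.hasDerivAt_length ht) hA hL
  simp only [Real.sqrt_sq (norm_nonneg _)] at h1
  refine (h1.sub h2).congr_deriv ?_
  simp only [Pi.sub_apply]
  change _ / (2 * ‖F.γ w t - F.γ u t‖) - (_ * (prof (F.amp a t) z - z * prof' (F.amp a t) z)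
    + _ * prof' (F.amp a t) z + _ * (Real.sin (π * z) / π * profR (F.amp a t) z - prof (F.amp a t) z)) = _
  field_simp
  ring

end Continuity

end SphereCSF

/-- A function attaining its minimum over a left neighbourhood has nonpositive derivative. -/
lemma HasDerivAt.nonpos_of_left_min {f : ℝ → ℝ} {f' x c : ℝ} (hf : HasDerivAt f f' x) (hc : c < x)
    (hmin : ∀ y ∈ Set.Ico c x, f x ≤ f y) : f' ≤ 0 := by
  have h := hasDerivWithinAt_iff_tendsto_slope' (s := Set.Iio x) (by simp) |>.1
    hf.hasDerivWithinAt
  refine le_of_tendsto h ?_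
  filter_upwards [Ico_mem_nhdsLT hc] with y hy
  rw [slope_def_field]
  exact div_nonpos_of_nonneg_of_nonpos (by linarith [hmin y hy]) (by linarith [hy.2])

namespace SphereCSF

section Periodicity

variable {D : Set ℝ} (F : SphereCSF D) {t : ℝ}

lemma integral_speed_period (ht : t ∈ D) (u : ℝ) :
    ∫ x in u..(u + 2 * π), F.speed x t = F.length t := by
  simpa [length] using (F.periodic_speed ht).intervalIntegral_add_eq u 0

lemma integral_speed_add (ht : t ∈ D) (u v w : ℝ) :
    (∫ x in u..v, F.speed x t) + ∫ x in v..w, F.speed x t = ∫ x in u..w, F.speed x t :=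
  intervalIntegral.integral_add_adjacent_intervals
    ((F.contDiff_speed ht).continuous.intervalIntegrable _ _)
    ((F.contDiff_speed ht).continuous.intervalIntegrable _ _)

lemma periodic_integral_speed (ht : t ∈ D) (h : ℝ) :
    Function.Periodic (fun u => ∫ x in u..(u + h), F.speed x t) (2 * π) := by
  intro u
  have h1 := F.integral_speed_add ht u (u + 2 * π) (u + 2 * π + h)
  have h2 := F.integral_speed_add ht u (u + h) (u + h + 2 * π)
  rw [F.integral_speed_period ht] at h1 h2
  rw [show u + h + 2 * π = u + 2 * π + h by ring] at h2
  dsimp only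
  linarith

lemma periodic_displacement (ht : t ∈ D) (h : ℝ) :
    Function.Periodic (fun u => F.γ (u + h) t - F.γ u t) (2 * π) := by
  intro u
  have h1 := F.periodic t ht u
  have h2 := F.periodic t ht (u + h)
  dsimp only at h1 h2 ⊢
  rw [h1, show u + 2 * π + h = u + h + 2 * π by ring, h2]

lemma displacement_ne_zero (ht : t ∈ D) {h : ℝ} (h0 : 0 < h) (h1 : h < 2 * π) (u : ℝ) :
    F.γ (u + h) t - F.γ u t ≠ 0 := by
  obtain ⟨y, hy, hyu⟩ := (F.periodic_displacement ht h).exists_mem_Ico₀ (by positivity) u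
  rw [hyu, sub_ne_zero]
  intro heq
  rcases lt_or_ge (y + h) (2 * π) with hlt | hge
  · have := F.simple t ht ⟨by linarith [hy.1], hlt⟩ hy heq
    linarith
  · have hp := F.periodic t ht (y + h - 2 * π)
    dsimp only at hp
    rw [sub_add_cancel] at hp
    have := F.simple t ht ⟨by linarith, by linarith [hy.2]⟩ hy (hp.symm.trans heq)
    linarith

lemma sin_arcLen (ht : t ∈ D) (u v : ℝ) :
    Real.sin (π * F.arcLen t u v / F.length t) =
      Real.sin (π * (|∫ x in u..v, F.speed x t| / F.length t)) := by
  have hL := F.length_pos ht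
  unfold arcLen
  rcases min_choice |∫ x in u..v, F.speed x t| (F.length t - |∫ x in u..v, F.speed x t|)
    with h | h <;> rw [h]
  · rw [mul_div_assoc]
  · rw [← Real.sin_pi_sub]
    congr 1
    field_simp
    ring

lemma arctan_bound_iff (ht : t ∈ D) (A u v : ℝ) :
    A⁻¹ * Real.arctan (A / π * Real.sin (π * F.arcLen t u v / F.length t))
        ≤ F.chord t u v / F.length t ↔
      F.length t * prof A (|∫ x in u..v, F.speed x t| / F.length t) ≤ ‖F.γ v t - F.γ u t‖ := by
  rw [F.sin_arcLen ht, le_div_iff₀ (F.length_pos ht), chord, norm_sub_rev, prof, mul_comm,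
    inv_mul_eq_div]

end Periodicity

variable {T : ℝ} (F : SphereCSF (Set.Ico 0 T)) {t b : ℝ}

lemma periodic_gap (a : ℝ) (ht : t ∈ Set.Ico 0 T) (h : ℝ) :
    Function.Periodic (fun u => F.gap a t u (u + h)) (2 * π) := by
  intro u
  have h1 := F.periodic_displacement ht h u
  have h2 := F.periodic_integral_speed ht h u
  dsimp only [gap] at h1 h2 ⊢
  rw [h1, h2]

lemma gap_initial_nonneg {a : ℝ} (hT : 0 < T)
    (h0 : ∀ u ∈ Set.Ico (0 : ℝ) (2 * π), ∀ v ∈ Set.Ico (0 : ℝ) (2 * π),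
      F.chord 0 u v / F.length 0
        ≥ a⁻¹ * Real.arctan (a / π * Real.sin (π * F.arcLen 0 u v / F.length 0)))
    {h : ℝ} (hh : h ∈ Set.Icc 0 (2 * π)) (u : ℝ) : 0 ≤ F.gap a 0 u (u + h) := by
  have ht : (0:ℝ) ∈ Set.Ico 0 T := ⟨le_rfl, hT⟩
  have hL := F.length_pos ht
  obtain ⟨y, hy, hyu⟩ := (F.periodic_gap a ht h).exists_mem_Ico₀ (by positivity) u
  have hA : F.amp a 0 = a := by simp [amp, tau]
  have hpos : ∀ p q, p ≤ q → 0 ≤ ∫ x in p..q, F.speed x 0 := fun p q hpq =>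
    intervalIntegral.integral_nonneg hpq fun x _ => (F.speed_pos ht x).le
  rw [hyu, gap, hA, sub_nonneg]
  rcases lt_or_ge (y + h) (2 * π) with hlt | hge
  · have h1 := (F.arctan_bound_iff ht a y (y + h)).1 (h0 y hy _ ⟨by linarith [hy.1, hh.1], hlt⟩)
    rwa [abs_of_nonneg (hpos _ _ (by linarith [hh.1]))] at h1
  · have h1 := (F.arctan_bound_iff ht a (y + h - 2 * π) y).1
      (h0 _ ⟨by linarith, by linarith [hy.2, hh.2]⟩ y hy)
    rw [abs_of_nonneg (hpos _ _ (by linarith [hh.2]))] at h1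
    have h2 := F.integral_speed_add ht (y + h - 2 * π) y (y + h)
    have h3 := F.integral_speed_period ht (y + h - 2 * π)
    have hp := F.periodic 0 ht (y + h - 2 * π)
    dsimp only at hp
    rw [sub_add_cancel] at h3 hp
    rw [← hp, norm_sub_rev] at h1
    rwa [show (∫ x in y..(y + h), F.speed x 0) / F.length 0
      = 1 - (∫ x in (y + h - 2 * π)..y, F.speed x 0) / F.length 0 by
        rw [eq_sub_iff_add_eq, ← add_div, div_eq_one_iff_eq hL.ne']; linarith, prof_one_sub]

/-- The chord-arc gap stays nonnegative along the flow. -/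
lemma gap_nonneg {a : ℝ} (ha : 0 < a)
    (hinit : ∀ h ∈ Set.Icc 0 (2 * π), ∀ u, 0 ≤ F.gap a 0 u (u + h)) (hb : b ∈ Set.Ico 0 T)
    {h : ℝ} (hh : h ∈ Set.Icc 0 (2 * π)) (u : ℝ) : 0 ≤ F.gap a b u (u + h) := by
  set K : Set (ℝ × ℝ × ℝ) := Set.Icc 0 b ×ˢ (Set.Icc 0 (2 * π) ×ˢ Set.Icc 0 (2 * π)) with hK
  have hKc : IsCompact K := isCompact_Icc.prod (isCompact_Icc.prod isCompact_Icc)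
  have hpi : (0:ℝ) ≤ 2 * π := by positivity
  have hcont : ContinuousOn (fun p : ℝ × ℝ × ℝ =>
      Real.exp (-3 * p.1) * F.gap a p.1 p.2.1 (p.2.1 + p.2.2)) K := by
    refine ContinuousOn.mul (by fun_prop) ?_
    exact (F.continuousOn_gap ha hb).comp
      (f := fun p : ℝ × ℝ × ℝ => (p.1, p.2.1, p.2.1 + p.2.2)) (by fun_prop)
      fun p hp => ⟨hp.1, Set.mem_univ _⟩
  obtain ⟨⟨s, u₀, k⟩, ⟨hs, hu₀, hk⟩, hmin⟩ := hKc.exists_isMinOn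
    ⟨(0, 0, 0), ⟨le_rfl, hb.1⟩, ⟨le_rfl, hpi⟩, ⟨le_rfl, hpi⟩⟩ hcont
  dsimp only at hs hu₀ hk
  have hle : ∀ r ∈ Set.Icc 0 b, ∀ v, ∀ q ∈ Set.Icc 0 (2 * π),
      Real.exp (-3 * s) * F.gap a s u₀ (u₀ + k) ≤ Real.exp (-3 * r) * F.gap a r v (v + q) := by
    intro r hr v q hq
    obtain ⟨y, hy, hyv⟩ := (F.periodic_gap a ⟨hr.1, hr.2.trans_lt hb.2⟩ q).exists_mem_Ico₀
      (by positivity) v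
    rw [hyv]
    exact hmin (a := (r, y, q)) ⟨hr, ⟨hy.1, hy.2.le⟩, hq⟩
  suffices hmain : 0 ≤ F.gap a s u₀ (u₀ + k) by
    have h1 := (mul_nonneg (Real.exp_pos (-3 * s)).le hmain).trans
      (hle b ⟨hb.1, le_rfl⟩ u h hh)
    exact nonneg_of_mul_nonneg_right h1 (Real.exp_pos _)
  by_contra! hneg
  have hsI : s ∈ Set.Ico 0 T := ⟨hs.1, hs.2.trans_lt hb.2⟩
  have hL := F.length_pos hsI
  have hs0 : 0 < s := by
    refine hs.1.lt_of_ne ?_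
    rintro rfl
    exact hneg.not_ge (hinit k hk u₀)
  have hsO : s ∈ Set.Ioo 0 T := ⟨hs0, hsI.2⟩
  have hk0 : 0 < k := by
    refine hk.1.lt_of_ne ?_
    rintro rfl
    simp [gap, prof_zero] at hneg
  have hk1 : k < 2 * π := by
    refine hk.2.lt_of_ne ?_
    rintro rfl
    simp only [gap, F.integral_speed_period hsI, div_self hL.ne', prof_one, mul_zero,
      sub_zero] at hneg
    exact hneg.not_ge (norm_nonneg _)
  have hd : 0 < ‖F.γ (u₀ + k) s - F.γ u₀ s‖ :=
    norm_pos_iff.2 (F.displacement_ne_zero hsI hk0 hk1 u₀)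
  have hstatic := F.static_estimate_slice hsI (a := F.amp a s) (η := -F.gap a s u₀ (u₀ + k))
    (u0 := u₀) (w0 := u₀ + k) (F.amp_pos ha) (by linarith) (by linarith) (by linarith)
    (by
      intro p q hpq hqp
      have h1 := hle s hs p (q - p) ⟨by linarith, by linarith⟩
      rw [add_sub_cancel] at h1
      have h2 := le_of_mul_le_mul_left h1 (Real.exp_pos _)
      unfold gap at h2 ⊢
      linarith)
    (by unfold gap; ring) hd
  have hderiv := F.hasDerivAt_gap (u := u₀) (w := u₀ + k) ha hsO hd
  dsimp only at hstatic hderiv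
  set E := inner ℝ (F.γ (u₀ + k) s - F.γ u₀ s) (curvVec F.γ (u₀ + k) s - curvVec F.γ u₀ s)
      / ‖F.γ (u₀ + k) s - F.γ u₀ s‖ + _ + _ - _ with hE
  have hexp : HasDerivAt (fun r : ℝ => Real.exp (-3 * r)) (Real.exp (-3 * s) * (-3)) s := by
    simpa using ((hasDerivAt_id s).const_mul (-3)).exp
  have hnonpos := (hexp.mul hderiv).nonpos_of_left_min hs0 fun r hr =>
    hle r ⟨hr.1, (hr.2.le).trans hs.2⟩ u₀ k hk
  have hpos := Real.exp_pos (-3 * s)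
  nlinarith

end SphereCSF

/-- The sharp chord-arc estimate for curve shortening flow on the unit sphere: if at
`t = 0` the profile inequality `d/L ≥ a⁻¹ arctan((a/π) sin(πℓ/L))` holds for some `a > 0`
and all pairs of points, then for all `t ∈ [0,T)` and all pairs of points,
`d/L ≥ (a e^{−4π²τ})⁻¹ arctan((a e^{−4π²τ}/π) sin(πℓ/L))` where `τ(t) = ∫₀ᵗ L⁻² ds`. -/
theorem chord_arc_estimate (T : ℝ) (hT : 0 < T)
    (F : SphereCSF (Set.Ico 0 T)) (a : ℝ) (ha : 0 < a)
    (h0 : ∀ u ∈ Set.Ico (0 : ℝ) (2 * π), ∀ v ∈ Set.Ico (0 : ℝ) (2 * π),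
      F.chord 0 u v / F.length 0
        ≥ a⁻¹ * Real.arctan (a / π * Real.sin (π * F.arcLen 0 u v / F.length 0)))
    (t : ℝ) (ht : t ∈ Set.Ico (0 : ℝ) T)
    (u : ℝ) (hu : u ∈ Set.Ico (0 : ℝ) (2 * π))
    (v : ℝ) (hv : v ∈ Set.Ico (0 : ℝ) (2 * π)) :
    F.chord t u v / F.length t
      ≥ (a * Real.exp (-4 * π ^ 2 * F.tau t))⁻¹ *
          Real.arctan (a * Real.exp (-4 * π ^ 2 * F.tau t) / π *
            Real.sin (π * F.arcLen t u v / F.length t)) := by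
  have key : ∀ p q, p ≤ q → q ≤ p + 2 * π →
      F.length t * prof (F.amp a t) (|∫ x in p..q, F.speed x t| / F.length t)
        ≤ ‖F.γ q t - F.γ p t‖ := by
    intro p q hpq hqp
    have h1 := F.gap_nonneg ha (fun h hh u => F.gap_initial_nonneg hT h0 hh u) ht
      (h := q - p) ⟨by linarith, by linarith⟩ p
    rw [add_sub_cancel, SphereCSF.gap, sub_nonneg] at h1
    rwa [abs_of_nonneg (intervalIntegral.integral_nonneg hpq fun x _ => (F.speed_pos ht x).le)]
  refine (F.arctan_bound_iff ht (F.amp a t) u v).2 ?_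
  rcases le_total u v with h | h
  · exact key u v h (by linarith [hu.1, hv.2])
  · have h1 := key v u h (by linarith [hv.1, hu.2])
    rwa [intervalIntegral.integral_symm, abs_neg, norm_sub_rev] at h1

end
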